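/- Let Assumption A hold with γ as in (C1). If the switched system ẋ = f(t,x,u,σ) is 0-GUAS w.r.t. S and UBEBS w.r.t. S with UBEBS gain α, then it is iISS w.r.t. S with iISS gain χ = max{α, γ} and moreover it is χ-BEICS w.r.t. S (every solution with input of finite χ-energy converges to 0 as t → ∞). -/

import Mathlib

open MeasureTheory Set Filter Topology

noncomputable section

/-- A class-`K` function: continuous and strictly increasing on `[0,∞)` with `φ 0 = 0`. -/
def ClassK (φ : ℝ → ℝ) : Prop :=
  ContinuousOn φ (Set.Ici 0) ∧ StrictMonoOn φ (Set.Ici 0) ∧ φ 0 = 0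

/-- A class-`K∞` function: class `K` and unbounded. -/
def ClassKInf (φ : ℝ → ℝ) : Prop :=
  ClassK φ ∧ Filter.Tendsto φ Filter.atTop Filter.atTop

/-- A class-`KL` function: `β (·, t)` is of class `K∞` for each `t ≥ 0` and `β (r, ·)`
decreases monotonically to `0` for each fixed `r ≥ 0`. -/
def ClassKL (β : ℝ → ℝ → ℝ) : Prop :=
  (∀ t, 0 ≤ t → ClassKInf fun r => β r t) ∧
  (∀ r, 0 ≤ r → AntitoneOn (fun t => β r t) (Set.Ici 0) ∧
    Filter.Tendsto (fun t => β r t) Filter.atTop (nhds 0))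

/-- A continuous positive definite function on `[0,∞)`. -/
def PosDefFun (φ : ℝ → ℝ) : Prop :=
  ContinuousOn φ (Set.Ici 0) ∧ φ 0 = 0 ∧ ∀ s, 0 < s → 0 < φ s

variable {Γ : Type*} {E : Type*} {F : Type*} {P : Type*}
  [NormedAddCommGroup E] [NormedSpace ℝ E]
  [NormedAddCommGroup F] [NormedSpace ℝ F]
  [NormedAddCommGroup P]
  [MeasurableSpace E] [MeasurableSpace F] [MeasurableSpace P]

/-- A switching signal: piecewise constant with finitely many discontinuities on every
bounded interval of `[0,∞)`, and right-continuous. -/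
def IsSwitchingSignal (σ : ℝ → Γ) : Prop :=
  ∀ b : ℝ, 0 < b → ∃ (n : ℕ) (t : ℕ → ℝ), t 0 = 0 ∧ (∀ i < n, t i < t (i + 1)) ∧ b ≤ t n ∧
    ∀ i < n, ∀ s ∈ Set.Ico (t i) (t (i + 1)), σ s = σ (t i)

/-- An admissible input: Lebesgue measurable and locally essentially bounded. -/
def IsInput (u : ℝ → F) : Prop :=
  Measurable u ∧ ∀ b : ℝ, ∃ C : ℝ, ∀ᵐ s ∂volume, s ∈ Set.Icc (0 : ℝ) b → ‖u s‖ ≤ C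

/-- A Carathéodory solution of `ẋ = f t x u σ` on the domain `D ⊆ [0,∞)` (an interval):
a continuous function satisfying the corresponding integral equation. -/
structure IsSolution (f : ℝ → E → F → Γ → E) (u : ℝ → F) (σ : ℝ → Γ)
    (D : Set ℝ) (x : ℝ → E) : Prop where
  ordConnected : D.OrdConnected
  subset_Ici : D ⊆ Set.Ici 0
  nonempty : D.Nonempty
  continuousOn : ContinuousOn x D
  intervalIntegrable : ∀ a ∈ D, ∀ b ∈ D,
    IntervalIntegrable (fun s => f s (x s) (u s) (σ s)) volume a b
  integral_eq : ∀ a ∈ D, ∀ b ∈ D, x b = x a + ∫ s in a..b, f s (x s) (u s) (σ s)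

/-- A maximally defined Carathéodory solution: one admitting no proper extension. -/
def IsMaximalSolution (f : ℝ → E → F → Γ → E) (u : ℝ → F) (σ : ℝ → Γ)
    (D : Set ℝ) (x : ℝ → E) : Prop :=
  IsSolution f u σ D x ∧
    ∀ D' : Set ℝ, ∀ x' : ℝ → E, IsSolution f u σ D' x' → D ⊆ D' → Set.EqOn x x' D → D' ⊆ D

/-- Standing regularity assumptions on `f`: vanishing at the origin for zero input,
Lebesgue measurable in `t`, continuous in `(ξ, μ)`. -/
def Regular (f : ℝ → E → F → Γ → E) : Prop :=
  (∀ t, 0 ≤ t → ∀ i, f t 0 0 i = 0) ∧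
  (∀ ξ μ i, Measurable fun t => f t ξ μ i) ∧
  (∀ t i, Continuous fun q : E × F => f t q.1 q.2 i)

/-- Forward completeness w.r.t. `S`. -/
def ForwardComplete (f : ℝ → E → F → Γ → E) (S : Set (ℝ → Γ)) : Prop :=
  ∀ t₀, 0 ≤ t₀ → ∀ u : ℝ → F, IsInput u → ∀ σ ∈ S, ∀ D x,
    IsMaximalSolution f u σ D x → t₀ ∈ D → Set.Ici t₀ ⊆ D

/-- iISS w.r.t. `S` with iISS gain `χ`. -/
def IISS (f : ℝ → E → F → Γ → E) (S : Set (ℝ → Γ)) (χ : ℝ → ℝ) : Prop :=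
  ForwardComplete f S ∧
  ∃ β ρ, ClassKL β ∧ ClassK ρ ∧
    ∀ t₀, 0 ≤ t₀ → ∀ u : ℝ → F, IsInput u → ∀ σ ∈ S, ∀ D x,
      IsMaximalSolution f u σ D x → t₀ ∈ D → ∀ t ∈ D, t₀ ≤ t →
        ‖x t‖ ≤ β ‖x t₀‖ (t - t₀) + ρ (∫ s in t₀..t, χ ‖u s‖)

/-- 0-GUAS w.r.t. `S`. -/
def ZeroGUAS (f : ℝ → E → F → Γ → E) (S : Set (ℝ → Γ)) : Prop :=
  ∃ β, ClassKL β ∧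
    ∀ t₀, 0 ≤ t₀ → ∀ σ ∈ S, ∀ D x,
      IsMaximalSolution f (fun _ => (0 : F)) σ D x → t₀ ∈ D → ∀ t ∈ D, t₀ ≤ t →
        ‖x t‖ ≤ β ‖x t₀‖ (t - t₀)

/-- UBEBS w.r.t. `S` with UBEBS gain `α`. -/
def UBEBS (f : ℝ → E → F → Γ → E) (S : Set (ℝ → Γ)) (α : ℝ → ℝ) : Prop :=
  ∃ α₁ α₂ c, ClassK α₁ ∧ ClassK α₂ ∧ 0 ≤ c ∧
    ∀ t₀, 0 ≤ t₀ → ∀ u : ℝ → F, IsInput u → ∀ σ ∈ S, ∀ D x,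
      IsMaximalSolution f u σ D x → t₀ ∈ D → ∀ t ∈ D, t₀ ≤ t →
        ‖x t‖ ≤ α₁ ‖x t₀‖ + α₂ (∫ s in t₀..t, α ‖u s‖) + c

/-- The total `χ`-energy `∫_0^∞ χ(|u(s)|) ds` of an input, as an extended nonnegative real. -/
def Energy (χ : ℝ → ℝ) (u : ℝ → F) : ENNReal :=
  ∫⁻ s in Set.Ioi (0 : ℝ), ENNReal.ofReal (χ ‖u s‖)

/-- `χ`-BEICS w.r.t. `S`: every solution corresponding to an input of finite `χ`-energy
is defined for all future times and converges to `0`. -/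
def BEICS (f : ℝ → E → F → Γ → E) (S : Set (ℝ → Γ)) (χ : ℝ → ℝ) : Prop :=
  ∀ t₀, 0 ≤ t₀ → ∀ u : ℝ → F, IsInput u → ∀ σ ∈ S, ∀ D x,
    IsMaximalSolution f u σ D x → t₀ ∈ D → Energy χ u ≠ ⊤ →
      Set.Ici t₀ ⊆ D ∧ Filter.Tendsto x Filter.atTop (nhds 0)

/-- Condition (C1) of Assumption A, with the class-`K` function `γ`. -/
def CondC1 (f : ℝ → E → F → Γ → E) (γ : ℝ → ℝ) : Prop :=
  ∃ N : ℝ → ℝ, (∀ r, 0 ≤ r → 0 < N r) ∧ MonotoneOn N (Set.Ici 0) ∧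
    ∀ t, 0 ≤ t → ∀ (ξ : E) (μ : F) (i : Γ), ‖f t ξ μ i‖ ≤ N ‖ξ‖ * (1 + γ ‖μ‖)

/-- Condition (C2) of Assumption A. -/
def CondC2 (f : ℝ → E → F → Γ → E) : Prop :=
  ∀ r, 0 < r → ∀ ε, 0 < ε → ∃ δ, 0 < δ ∧ ∀ t, 0 ≤ t → ∀ (i : Γ) (ξ : E) (μ : F),
    ‖ξ‖ ≤ r → ‖μ‖ ≤ δ → ‖f t ξ μ i - f t ξ 0 i‖ < ε

/-- Condition (C3) of Assumption A: `f (t, ξ, 0, i)` is locally Lipschitz in `ξ`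
uniformly in `t` and `i`. -/
def CondC3 (f : ℝ → E → F → Γ → E) : Prop :=
  ∀ K : Set E, IsCompact K → ∃ L, 0 ≤ L ∧ ∀ t, 0 ≤ t → ∀ (i : Γ), ∀ ξ ∈ K, ∀ ξ' ∈ K,
    ‖f t ξ 0 i - f t ξ' 0 i‖ ≤ L * ‖ξ - ξ'‖

/-- Assumption A, with `γ` the class-`K` function appearing in (C1). -/
def AssumptionA (f : ℝ → E → F → Γ → E) (γ : ℝ → ℝ) : Prop :=
  ClassK γ ∧ CondC1 f γ ∧ CondC2 f ∧ CondC3 f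

/-- Sandwich bounds `φ₁(|ξ|) ≤ V(t,ξ) ≤ φ₂(|ξ|)` with `φ₁, φ₂` of class `K∞`. -/
def StorageBounds (V : ℝ → E → ℝ) : Prop :=
  ∃ φ₁ φ₂, ClassKInf φ₁ ∧ ClassKInf φ₂ ∧
    ∀ t, 0 ≤ t → ∀ ξ : E, φ₁ ‖ξ‖ ≤ V t ξ ∧ V t ξ ≤ φ₂ ‖ξ‖

/-- 0-OD (zero-output dissipativity) w.r.t. `S` witnessed by the storage function `V`
and the supply function `α`. -/
def ZeroODWithStorage (f : ℝ → E → F → Γ → E) (S : Set (ℝ → Γ)) (V : ℝ → E → ℝ)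
    (α : ℝ → ℝ) : Prop :=
  StorageBounds V ∧
    ∀ t₀, 0 ≤ t₀ → ∀ u : ℝ → F, IsInput u → ∀ σ ∈ S, ∀ D x,
      IsMaximalSolution f u σ D x → t₀ ∈ D → ∀ t ∈ D, t₀ ≤ t →
        V t (x t) ≤ V t₀ (x t₀) + ∫ s in t₀..t, α ‖u s‖

/-- 0-OD w.r.t. `S` with supply function `α`. -/
def ZeroOD (f : ℝ → E → F → Γ → E) (S : Set (ℝ → Γ)) (α : ℝ → ℝ) : Prop :=
  ∃ V : ℝ → E → ℝ, (∀ t ξ, 0 ≤ V t ξ) ∧ ZeroODWithStorage f S V α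

/-- `h`-OD (output dissipativity) w.r.t. `S` with supply function `α`. -/
def HOD (f : ℝ → E → F → Γ → E) (h : ℝ → E → F → Γ → P) (S : Set (ℝ → Γ))
    (α : ℝ → ℝ) : Prop :=
  ∃ V : ℝ → E → ℝ, (∀ t ξ, 0 ≤ V t ξ) ∧ StorageBounds V ∧
    ∃ α₃, PosDefFun α₃ ∧
      ∀ t₀, 0 ≤ t₀ → ∀ u : ℝ → F, IsInput u → ∀ σ ∈ S, ∀ D x,
        IsMaximalSolution f u σ D x → t₀ ∈ D → ∀ t ∈ D, t₀ ≤ t →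
          V t (x t) ≤ V t₀ (x t₀) - (∫ s in t₀..t, α₃ ‖h s (x s) (u s) (σ s)‖)
            + ∫ s in t₀..t, α ‖u s‖

/-- The pair `(h, f)` is zero-input output-persistently exciting w.r.t. `S`. -/
def OutputPE (f : ℝ → E → F → Γ → E) (h : ℝ → E → F → Γ → P)
    (S : Set (ℝ → Γ)) : Prop :=
  ∀ ε : ℝ, 0 < ε → ε ≤ 1 → ∃ T, 0 < T ∧ ∃ r, 0 < r ∧
    ∀ t₀, 0 ≤ t₀ → ∀ σ ∈ S, ∀ D x,
      IsMaximalSolution f (fun _ => (0 : F)) σ D x → t₀ ∈ D →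
        ∀ t, t₀ ≤ t → Set.Icc t (t + T) ⊆ D →
          (∀ τ ∈ Set.Icc t (t + T), ε ≤ ‖x τ‖ ∧ ‖x τ‖ ≤ 1 / ε) →
            r ≤ ∫ τ in t..(t + T), ‖h τ (x τ) 0 (σ τ)‖ ^ 2

/-- Standing regularity assumptions on the output map `h`. -/
def OutputRegular (h : ℝ → E → F → Γ → P) : Prop :=
  (∀ ξ μ i, Measurable fun t => h t ξ μ i) ∧
  (∀ t i, Continuous fun q : E × F => h t q.1 q.2 i) ∧
  ∀ K : Set E, IsCompact K → (0 : E) ∉ K → ∃ M : ℝ,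
    ∀ᵐ t ∂volume, 0 ≤ t → ∀ ξ ∈ K, ∀ i : Γ, ‖h t ξ 0 i‖ ≤ M

/-- The average of `g` over `[r, 2 r]`, written so that it is also meaningful at `r = 0`. -/
def dyadicAverage (g : ℝ → ℝ) (r : ℝ) : ℝ := ∫ s in (1 : ℝ)..2, g (r * s)

section DyadicAverage

variable {g : ℝ → ℝ}

lemma Monotone.intervalIntegrable_comp_mul (hg : Monotone g) {r : ℝ} (hr : 0 ≤ r) (a b : ℝ) :
    IntervalIntegrable (fun s => g (r * s)) volume a b :=
  Monotone.intervalIntegrable fun _ _ h => hg (mul_le_mul_of_nonneg_left h hr)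

lemma dyadicAverage_mono {g' : ℝ → ℝ} (hg : Monotone g) (hg' : Monotone g') {r r' : ℝ}
    (hr : 0 ≤ r) (hr' : 0 ≤ r') (h : ∀ s ∈ Icc (1 : ℝ) 2, g (r * s) ≤ g' (r' * s)) :
    dyadicAverage g r ≤ dyadicAverage g' r' :=
  intervalIntegral.integral_mono_on (by norm_num) (hg.intervalIntegrable_comp_mul hr _ _)
    (hg'.intervalIntegrable_comp_mul hr' _ _) h

lemma dyadicAverage_const (c r : ℝ) : dyadicAverage (fun _ => c) r = c := by
  norm_num [dyadicAverage]

lemma le_dyadicAverage (hg : Monotone g) {r : ℝ} (hr : 0 ≤ r) : g r ≤ dyadicAverage g r := by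
  rw [← dyadicAverage_const (g r) r]
  exact dyadicAverage_mono monotone_const hg hr hr fun s hs => hg (by nlinarith [hs.1])

lemma dyadicAverage_le (hg : Monotone g) {r : ℝ} (hr : 0 ≤ r) :
    dyadicAverage g r ≤ g (2 * r) := by
  rw [← dyadicAverage_const (g (2 * r)) r]
  exact dyadicAverage_mono hg monotone_const hr hr fun s hs => hg (by nlinarith [hs.2])

lemma monotoneOn_dyadicAverage (hg : Monotone g) : MonotoneOn (dyadicAverage g) (Ici 0) :=
  fun _ hr _ hr' h => dyadicAverage_mono hg hg hr hr' fun _ hs =>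
    hg (mul_le_mul_of_nonneg_right h (by linarith [hs.1]))

lemma continuousOn_dyadicAverage (hg : Monotone g) (h0 : 0 ≤ g 0)
    (hsmall : ∀ ε > 0, ∃ δ > 0, g δ ≤ ε) : ContinuousOn (dyadicAverage g) (Ici 0) := by
  intro r hr
  rcases eq_or_lt_of_le (show (0 : ℝ) ≤ r from hr) with rfl | hr
  · rw [Metric.continuousWithinAt_iff]
    intro ε hε
    obtain ⟨δ, hδ, hgδ⟩ := hsmall (ε / 2) (by positivity)
    have hz : g 0 = 0 := by
      refine le_antisymm (le_of_forall_pos_le_add fun ε hε => ?_) h0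
      obtain ⟨δ, hδ, h⟩ := hsmall ε hε
      linarith [hg hδ.le]
    have havg0 : dyadicAverage g 0 = 0 := by simp [dyadicAverage, hz]
    refine ⟨δ / 2, by positivity, fun {s} hs hd => ?_⟩
    have hs : 0 ≤ s := hs
    rw [havg0, Real.dist_eq, sub_zero]
    rw [Real.dist_eq, sub_zero, abs_of_nonneg hs] at hd
    have h1 := dyadicAverage_le hg hs
    have h2 := le_dyadicAverage hg hs
    have h3 : g (2 * s) ≤ g δ := hg (by linarith)
    have h4 := hg hs
    rw [abs_of_nonneg (by linarith)]
    linarith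
  · have hP : Continuous fun b => ∫ s in (0 : ℝ)..b, g s :=
      intervalIntegral.continuous_primitive (fun a b => hg.intervalIntegrable) 0
    have hc : ContinuousAt
        (fun r => r⁻¹ * ((∫ s in (0 : ℝ)..(r * 2), g s) - ∫ s in (0 : ℝ)..(r * 1), g s)) r := by
      refine ContinuousAt.mul (continuousAt_inv₀ hr.ne') (Continuous.continuousAt ?_)
      exact (hP.comp (by fun_prop)).sub (hP.comp (by fun_prop))
    refine (hc.congr ?_).continuousWithinAt
    filter_upwards [lt_mem_nhds hr] with s hs
    rw [dyadicAverage, intervalIntegral.integral_comp_mul_left _ hs.ne',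
      intervalIntegral.integral_interval_sub_left hg.intervalIntegrable hg.intervalIntegrable]
    simp

lemma classKInf_dyadicAverage_add (hg : Monotone g) (h0 : 0 ≤ g 0)
    (hsmall : ∀ ε > 0, ∃ δ > 0, g δ ≤ ε) {c : ℝ} (hc : 0 < c) :
    ClassKInf fun r => dyadicAverage g r + c * r := by
  have hz : g 0 = 0 := by
    refine le_antisymm (le_of_forall_pos_le_add fun ε hε => ?_) h0
    obtain ⟨δ, hδ, h⟩ := hsmall ε hε
    linarith [hg hδ.le]
  refine ⟨⟨(continuousOn_dyadicAverage hg h0 hsmall).add (by fun_prop), ?_, ?_⟩, ?_⟩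
  · intro r hr s hs h
    have := monotoneOn_dyadicAverage hg hr hs h.le
    have := mul_lt_mul_of_pos_left h hc
    simp only
    linarith
  · simp [dyadicAverage, hz]
  · refine tendsto_atTop_mono' atTop ?_ (tendsto_id.const_mul_atTop hc)
    filter_upwards [eventually_ge_atTop 0] with r hr
    have := le_dyadicAverage hg hr
    have := hg hr
    simp only [id]
    linarith

end DyadicAverage

section ClassK

variable {φ : ℝ → ℝ}

lemma ClassK.mono (h : ClassK φ) {r s : ℝ} (hr : 0 ≤ r) (hrs : r ≤ s) : φ r ≤ φ s :=
  h.2.1.monotoneOn hr (hr.trans hrs) hrs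

lemma ClassK.nonneg (h : ClassK φ) {r : ℝ} (hr : 0 ≤ r) : 0 ≤ φ r := by
  simpa [h.2.2] using h.mono le_rfl hr

lemma ClassK.pos (h : ClassK φ) {r : ℝ} (hr : 0 < r) : 0 < φ r := by
  simpa [h.2.2] using h.2.1 (mem_Ici.2 le_rfl) hr.le hr

lemma ClassK.exists_le (h : ClassK φ) {ε : ℝ} (hε : 0 < ε) : ∃ δ > 0, φ δ ≤ ε := by
  have h1 := Metric.continuousWithinAt_iff.1 (h.1 0 (mem_Ici.2 le_rfl)) ε hε
  obtain ⟨δ, hδ, hd⟩ := h1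
  refine ⟨δ / 2, by positivity, ?_⟩
  have := hd (x := δ / 2) (mem_Ici.2 (by positivity))
    (by rw [Real.dist_eq, sub_zero, abs_of_pos (by positivity)]; linarith)
  rw [h.2.2, Real.dist_eq, sub_zero] at this
  exact (le_abs_self _).trans this.le

lemma classK_max {ψ : ℝ → ℝ} (hφ : ClassK φ) (hψ : ClassK ψ) :
    ClassK fun s => max (φ s) (ψ s) :=
  ⟨ContinuousOn.sup hφ.1 hψ.1, fun _ hr _ hs h => max_lt_max (hφ.2.1 hr hs h) (hψ.2.1 hr hs h),
    by simp [hφ.2.2, hψ.2.2]⟩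

/-- If `v` is bounded in terms of `(r, e)` on bounded sets, with a bound that vanishes as
`(r, e) → 0`, then it is bounded by `a r + a e` for a class-`K∞` function `a`. -/
lemma exists_classKInf_bound {P : ℝ → ℝ → ℝ → Prop}
    (hP : ∀ r e v, P r e v → 0 ≤ r ∧ 0 ≤ e)
    (hsmall : ∀ ε > 0, ∃ δ > 0, ∀ r e v, P r e v → r ≤ δ → e ≤ δ → v ≤ ε)
    (hbdd : ∀ R, ∃ B, ∀ r e v, P r e v → r ≤ R → e ≤ R → v ≤ B) :
    ∃ a, ClassKInf a ∧ ∀ r e v, P r e v → v ≤ a r + a e := by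
  set A : ℝ → Set ℝ := fun R => insert 0 {v | ∃ r e, P r e v ∧ r ≤ R ∧ e ≤ R} with hA
  have hAne (R) : (A R).Nonempty := ⟨0, mem_insert _ _⟩
  have hAb (R) : BddAbove (A R) := by
    obtain ⟨B, hB⟩ := hbdd R
    refine BddAbove.insert _ ⟨B, ?_⟩
    rintro v ⟨r, e, h, hr, he⟩
    exact hB r e v h hr he
  set g : ℝ → ℝ := fun R => sSup (A R) with hgdef
  have hg : Monotone g := fun R R' h => csSup_le_csSup (hAb R') (hAne R) <|
    insert_subset_insert fun v ⟨r, e, hv, hr, he⟩ => ⟨r, e, hv, hr.trans h, he.trans h⟩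
  have hg0 (R) : 0 ≤ g R := le_csSup (hAb R) (mem_insert _ _)
  have hgs : ∀ ε > 0, ∃ δ > 0, g δ ≤ ε := fun ε hε => by
    obtain ⟨δ, hδ, h⟩ := hsmall ε hε
    refine ⟨δ, hδ, csSup_le (hAne δ) ?_⟩
    rintro v (rfl | ⟨r, e, hv, hr, he⟩)
    · exact hε.le
    · exact h r e v hv hr he
  refine ⟨_, classKInf_dyadicAverage_add hg (hg0 0) hgs one_pos, fun r e v hv => ?_⟩
  obtain ⟨hr, he⟩ := hP r e v hv
  have h1 : v ≤ g (max r e) :=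
    le_csSup (hAb _) (mem_insert_of_mem _ ⟨r, e, hv, le_max_left _ _, le_max_right _ _⟩)
  have h2 := le_dyadicAverage hg hr
  have h3 := le_dyadicAverage hg he
  have h4 := hg0 r
  have h5 := hg0 e
  rcases max_choice r e with h | h <;> rw [h] at h1 <;> linarith

/-- A bound `v ≤ a r + a e` together with attractivity up to `a e`, uniform for bounded
`(r, e)`, yields a bound of the form `v ≤ β (r, s) + ρ e`. -/
lemma exists_classKL_bound {P : ℝ → ℝ → ℝ → ℝ → Prop} {a : ℝ → ℝ} (ha : ClassKInf a)
    (hP : ∀ r e s v, P r e s v → 0 ≤ r ∧ 0 ≤ e ∧ 0 ≤ s)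
    (hbdd : ∀ r e s v, P r e s v → v ≤ a r + a e)
    (hattr : ∀ R ≥ 0, ∀ ε > 0, ∃ T, ∀ r e s v, P r e s v → r ≤ R → e ≤ R → T ≤ s → v ≤ ε + a e) :
    ∃ β ρ, ClassKL β ∧ ClassK ρ ∧ ∀ r e s v, P r e s v → v ≤ β r s + ρ e := by
  have haK : ClassK a := ha.1
  set A : ℝ → ℝ → Set ℝ := fun R t =>
    insert 0 {w | ∃ r e s v, P r e s v ∧ r ≤ R ∧ e ≤ r ∧ t ≤ s ∧ w = v - 2 * a e} with hA
  have hAne (R t) : (A R t).Nonempty := ⟨0, mem_insert _ _⟩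
  have hAle (R t) (hR : 0 ≤ R) : ∀ w ∈ A R t, w ≤ a R := by
    rintro w (rfl | ⟨r, e, s, v, hv, hr, he, ht, rfl⟩)
    · exact haK.nonneg hR
    · obtain ⟨hr0, he0, hs0⟩ := hP _ _ _ _ hv
      linarith [hbdd _ _ _ _ hv, haK.nonneg he0, haK.mono hr0 hr]
  have hAb (R t) : BddAbove (A R t) := by
    refine ⟨a (max R 0), fun w hw => hAle _ t (le_max_right _ _) w ?_⟩
    refine insert_subset_insert ?_ hw
    rintro w ⟨r, e, s, v, hv, hr, h⟩
    exact ⟨r, e, s, v, hv, hr.trans (le_max_left _ _), h⟩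
  set g : ℝ → ℝ → ℝ := fun t R => sSup (A R t) with hgdef
  have hg (t) : Monotone (g t) := fun R R' h => csSup_le_csSup (hAb R' t) (hAne R t) <|
    insert_subset_insert fun w ⟨r, e, s, v, hv, hr, h'⟩ => ⟨r, e, s, v, hv, hr.trans h, h'⟩
  have hgt (R) : Antitone fun t => g t R := fun t t' h =>
    csSup_le_csSup (hAb R t) (hAne R t') <| insert_subset_insert
      fun w ⟨r, e, s, v, hv, hr, he, ht, h'⟩ => ⟨r, e, s, v, hv, hr, he, h.trans ht, h'⟩
  have hg0 (t R) : 0 ≤ g t R := le_csSup (hAb R t) (mem_insert _ _)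
  have hgs (t) : ∀ ε > 0, ∃ δ > 0, g t δ ≤ ε := fun ε hε => by
    obtain ⟨δ, hδ, h⟩ := haK.exists_le hε
    exact ⟨δ, hδ, csSup_le (hAne δ t) fun w hw => (hAle δ t hδ.le w hw).trans h⟩
  refine ⟨fun r t => dyadicAverage (g t) r + Real.exp (-t) * r, fun e => 2 * a e,
    ⟨fun t _ => classKInf_dyadicAverage_add (hg t) (hg0 t 0) (hgs t) (Real.exp_pos _), ?_⟩,
    ⟨continuousOn_const.mul haK.1, fun r hr s hs h => ?_, by simp [haK.2.2]⟩, ?_⟩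
  · refine fun r hr => ⟨fun t _ t' _ h => ?_, ?_⟩
    · exact add_le_add (dyadicAverage_mono (hg _) (hg _) hr hr fun s _ => hgt _ h)
        (mul_le_mul_of_nonneg_right (Real.exp_le_exp.2 (by linarith)) hr)
    · have hexp : Tendsto (fun t => Real.exp (-t) * r) atTop (𝓝 0) := by
        simpa using (Real.tendsto_exp_neg_atTop_nhds_zero).mul_const r
      have hlim : Tendsto (fun t => g t (2 * r)) atTop (𝓝 0) := by
        rw [Metric.tendsto_atTop]
        intro ε hε
        obtain ⟨T, hT⟩ := hattr (2 * r) (by positivity) (ε / 2) (by positivity)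
        refine ⟨T, fun t ht => ?_⟩
        rw [Real.dist_eq, sub_zero, abs_of_nonneg (hg0 _ _)]
        refine lt_of_le_of_lt (csSup_le (hAne _ _) ?_) (half_lt_self hε)
        rintro w (rfl | ⟨r', e, s, v, hv, hr', he, hs, rfl⟩)
        · positivity
        · linarith [hT _ _ _ _ hv hr' (he.trans hr') (ht.trans hs),
            haK.nonneg (hP _ _ _ _ hv).2.1]
      have := squeeze_zero (fun t => (hg0 t r).trans (le_dyadicAverage (hg t) hr))
        (fun t => dyadicAverage_le (hg t) hr) hlim
      simpa using this.add hexp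
  · have := haK.2.1 hr hs h
    simp only
    linarith
  · intro r e s v hv
    obtain ⟨hr, he, hs⟩ := hP _ _ _ _ hv
    have h1 : g s r ≤ dyadicAverage (g s) r := le_dyadicAverage (hg s) hr
    have h2 : 0 ≤ Real.exp (-s) * r := by positivity
    have h3 := hg0 s r
    rcases le_total e r with h | h
    · have : v - 2 * a e ≤ g s r :=
        le_csSup (hAb _ _) (mem_insert_of_mem _ ⟨r, e, s, v, hv, le_rfl, h, le_rfl, rfl⟩)
      simp only
      linarith
    · have := hbdd _ _ _ _ hv
      have := haK.mono hr h
      simp only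
      linarith

end ClassK

section Caratheodory

variable {E : Type*} [NormedAddCommGroup E]

lemma intervalIntegrable_comp_of_bound {g : ℝ → E → E} {M : ℝ} (hM : ∀ s w, ‖g s w‖ ≤ M)
    (hm : ∀ y : ℝ → E, Continuous y → AEStronglyMeasurable fun s => g s (y s))
    {y : ℝ → E} (hy : Continuous y) (a b : ℝ) :
    IntervalIntegrable (fun s => g s (y s)) volume a b :=
  (intervalIntegrable_const (c := M)).mono_fun' (hm y hy).restrict
    (ae_of_all _ fun s => hM s (y s))

variable [NormedSpace ℝ E]

/-- Picard-type iterates for the delayed equation `ẏ(t) = g (t - δ, y (t - δ))`, frozen at `ξ` up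
to time `b + δ`. -/
def delayIterate (g : ℝ → E → E) (b : ℝ) (ξ : E) (δ : ℝ) : ℕ → ℝ → E
  | 0 => fun _ => ξ
  | j + 1 => fun t => ξ + ∫ s in b..max b (t - δ), g s (delayIterate g b ξ δ j s)

variable {g : ℝ → E → E} {M : ℝ}

lemma continuous_delayIterate (hM : ∀ s w, ‖g s w‖ ≤ M)
    (hm : ∀ y : ℝ → E, Continuous y → AEStronglyMeasurable fun s => g s (y s))
    (b : ℝ) (ξ : E) (δ : ℝ) (j : ℕ) : Continuous (delayIterate g b ξ δ j) := by
  induction j with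
  | zero => exact continuous_const
  | succ j ih =>
    exact continuous_const.add ((intervalIntegral.continuous_primitive
      (fun _ _ => intervalIntegrable_comp_of_bound hM hm ih _ _) b).comp (by fun_prop))

lemma dist_delayIterate_le (hM : ∀ s w, ‖g s w‖ ≤ M)
    (hm : ∀ y : ℝ → E, Continuous y → AEStronglyMeasurable fun s => g s (y s))
    (b : ℝ) (ξ : E) (δ : ℝ) (j : ℕ) (t t' : ℝ) :
    dist (delayIterate g b ξ δ j t) (delayIterate g b ξ δ j t') ≤ M * dist t t' := by
  have hM0 : 0 ≤ M := (norm_nonneg _).trans (hM 0 0)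
  cases j with
  | zero => simpa [delayIterate] using mul_nonneg hM0 dist_nonneg
  | succ j =>
    have hi := intervalIntegrable_comp_of_bound hM hm (continuous_delayIterate hM hm b ξ δ j)
    simp only [delayIterate, dist_add_left]
    rw [dist_eq_norm, intervalIntegral.integral_interval_sub_left (hi _ _) (hi _ _)]
    refine (intervalIntegral.norm_integral_le_of_norm_le_const fun s _ => hM s _).trans ?_
    refine mul_le_mul_of_nonneg_left ?_ hM0
    have h := abs_max_sub_max_le_abs (t - δ) (t' - δ) b
    rw [max_comm _ b, max_comm _ b] at h
    simpa [Real.dist_eq] using h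

lemma delayIterate_succ_eq {b δ : ℝ} (hδ : 0 ≤ δ) (ξ : E) (j : ℕ) :
    ∀ t ≤ b + j * δ, delayIterate g b ξ δ (j + 1) t = delayIterate g b ξ δ j t := by
  induction j with
  | zero =>
    intro t ht
    have : max b (t - δ) = b := max_eq_left (by simp at ht; linarith)
    simp [delayIterate, this]
  | succ j ih =>
    intro t ht
    change (ξ + ∫ s in b..max b (t - δ), g s (delayIterate g b ξ δ (j + 1) s)) =
      ξ + ∫ s in b..max b (t - δ), g s (delayIterate g b ξ δ j s)
    congr 1
    refine intervalIntegral.integral_congr fun s hs => ?_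
    rw [uIcc_of_le (le_max_left _ _)] at hs
    have hs2 : s ≤ b + j * δ := by
      refine hs.2.trans (max_le ?_ ?_)
      · have : 0 ≤ (j : ℝ) * δ := by positivity
        linarith
      · push_cast at ht
        linarith
    simp only [ih s hs2]

/-- Carathéodory's existence theorem for a globally bounded right-hand side. -/
theorem exists_caratheodory_solution [FiniteDimensional ℝ E] (hM : ∀ s w, ‖g s w‖ ≤ M)
    (hc : ∀ s, Continuous (g s))
    (hm : ∀ y : ℝ → E, Continuous y → AEStronglyMeasurable fun s => g s (y s)) (b : ℝ) (ξ : E) :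
    ∃ y : ℝ → E, Continuous y ∧ ∀ t ∈ Icc b (b + 1), y t = ξ + ∫ s in b..t, g s (y s) := by
  have hM0 : 0 ≤ M := (norm_nonneg _).trans (hM 0 0)
  have hb : b ≤ b + 1 := by linarith
  let δ : ℕ → ℝ := fun k => 1 / ((k : ℝ) + 1)
  have hδ (k) : 0 < δ k := Nat.one_div_pos_of_nat
  let X : ℕ → ℝ → E := fun k => delayIterate g b ξ (δ k) (k + 1)
  have hXc (k) : Continuous (X k) := continuous_delayIterate hM hm _ _ _ _
  have hint {y : ℝ → E} (hy : Continuous y) := intervalIntegrable_comp_of_bound hM hm hy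
  have hXball (k) (t) (ht : t ∈ Icc b (b + 1)) : X k t ∈ Metric.closedBall ξ M := by
    have h := dist_delayIterate_le hM hm b ξ (δ k) (k + 1) t b
    have hXb : delayIterate g b ξ (δ k) (k + 1) b = ξ := by
      have : max b (b - δ k) = b := max_eq_left (by linarith [hδ k])
      simp [delayIterate, this]
    rw [hXb, Real.dist_eq, abs_of_nonneg (by linarith [ht.1])] at h
    exact Metric.mem_closedBall.2 (h.trans (by nlinarith [ht.2]))
  have hXeq (k) (t) (ht : t ∈ Icc b (b + 1)) :
      dist (X k t) (ξ + ∫ s in b..t, g s (X k s)) ≤ M * δ k := by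
    have h1 : X k t = ξ + ∫ s in b..max b (t - δ k), g s (X k s) := by
      refine (delayIterate_succ_eq (g := g) (hδ k).le ξ (k + 1) t ?_).symm
      have : ((k : ℝ) + 1) * δ k = 1 := mul_one_div_cancel (by positivity)
      push_cast
      linarith [ht.2]
    rw [h1, dist_add_left, dist_eq_norm,
      intervalIntegral.integral_interval_sub_left (hint (hXc k) _ _) (hint (hXc k) _ _)]
    refine (intervalIntegral.norm_integral_le_of_norm_le_const fun s _ => hM s _).trans ?_
    refine mul_le_mul_of_nonneg_left ?_ hM0
    rw [abs_le]
    constructor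
    · linarith [le_max_right b (t - δ k)]
    · have : max b (t - δ k) ≤ t := max_le ht.1 (by linarith [hδ k])
      linarith [hδ k]
  let Z : ℕ → BoundedContinuousFunction (Icc b (b + 1)) E := fun k =>
    BoundedContinuousFunction.mkOfCompact ⟨fun t => X k t, (hXc k).comp continuous_subtype_val⟩
  have hcomp : IsCompact (closure (range Z)) := by
    refine BoundedContinuousFunction.arzela_ascoli (Metric.closedBall ξ M)
      (isCompact_closedBall ξ M) _ ?_ ?_
    · rintro _ t ⟨k, rfl⟩
      exact hXball k t t.2
    · refine Metric.equicontinuous_of_continuity_modulus (fun d => M * d) ?_ _ ?_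
      · simpa using (tendsto_id (x := 𝓝 (0 : ℝ))).const_mul M
      · rintro s t ⟨_, k, rfl⟩
        exact dist_delayIterate_le hM hm b ξ (δ k) (k + 1) s t
  obtain ⟨z, -, φ, hφ, hz⟩ :=
    hcomp.tendsto_subseq (x := Z) fun k => subset_closure (mem_range_self k)
  have hlim (t) (ht : t ∈ Icc b (b + 1)) :
      Tendsto (fun k => X (φ k) t) atTop (𝓝 (IccExtend hb z t)) := by
    rw [IccExtend_of_mem hb z ht]
    exact (BoundedContinuousFunction.tendsto_iff_tendstoUniformly.1 hz).tendsto_at ⟨t, ht⟩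
  have hyc : Continuous (IccExtend hb z) := z.continuous.Icc_extend'
  refine ⟨IccExtend hb z, hyc, fun t ht => ?_⟩
  have hI : Tendsto (fun k => ∫ s in b..t, g s (X (φ k) s)) atTop
      (𝓝 (∫ s in b..t, g s (IccExtend hb z s))) := by
    refine intervalIntegral.tendsto_integral_filter_of_dominated_convergence (fun _ => M)
      (Eventually.of_forall fun k => (hm _ (hXc _)).restrict)
      (Eventually.of_forall fun k => ae_of_all _ fun s _ => hM s _) intervalIntegrable_const
      (ae_of_all _ fun s hs => ?_)
    rw [uIoc_of_le ht.1] at hs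
    exact ((hc s).tendsto _).comp (hlim s ⟨hs.1.le, hs.2.trans ht.2⟩)
  have hdist : Tendsto (fun k => dist (X (φ k) t) (ξ + ∫ s in b..t, g s (X (φ k) s))) atTop
      (𝓝 0) := by
    refine squeeze_zero (fun _ => dist_nonneg) (fun k => hXeq (φ k) t ht) ?_
    have : Tendsto δ atTop (𝓝 0) := tendsto_one_div_add_atTop_nhds_zero_nat
    simpa using (this.comp hφ.tendsto_atTop).const_mul M
  exact dist_eq_zero.1 (tendsto_nhds_unique ((hlim t ht).dist (hI.const_add ξ)) hdist)

end Caratheodory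

/-- Grönwall's inequality in integral form. -/
lemma le_mul_exp_of_le_integral {w : ℝ → ℝ} {a b A L : ℝ} (hw : ContinuousOn w (Icc a b))
    (hL : 0 ≤ L) (h : ∀ t ∈ Icc a b, w t ≤ A + L * ∫ s in a..t, w s) :
    ∀ t ∈ Icc a b, w t ≤ A * Real.exp (L * (t - a)) := by
  intro t ht
  have hab : a ≤ b := ht.1.trans ht.2
  set v : ℝ → ℝ := IccExtend hab ((Icc a b).domRestrict w) with hv
  have hvc : Continuous v := (continuousOn_iff_continuous_domRestrict.1 hw).Icc_extend'
  have hvw (s) (hs : s ∈ Icc a b) : v s = w s := IccExtend_of_mem hab _ hs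
  set W : ℝ → ℝ := fun t => A + L * ∫ s in a..t, v s with hW
  have hd (t) : HasDerivAt W (L * v t) t :=
    ((intervalIntegral.integral_hasDerivAt_right (hvc.intervalIntegrable _ _)
      (hvc.stronglyMeasurableAtFilter _ _) hvc.continuousAt).const_mul L).const_add A
  have hle (t) (ht : t ∈ Icc a b) : v t ≤ W t := by
    rw [hvw t ht]
    refine (h t ht).trans_eq ?_
    simp only [hW]
    congr 2
    refine intervalIntegral.integral_congr fun s hs => ?_
    rw [uIcc_of_le ht.1] at hs
    exact (hvw s ⟨hs.1, hs.2.trans ht.2⟩).symm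
  have key := le_gronwallBound_of_liminf_deriv_right_le (f := W) (f' := fun t => L * v t)
    (δ := A) (K := L) (ε := 0) (a := a) (b := b)
    (fun t _ => (hd t).continuousAt.continuousWithinAt)
    (fun t _ r hr => (hd t).hasDerivWithinAt.liminf_right_slope_le hr) (by simp [hW])
    (fun t ht => by
      have := mul_le_mul_of_nonneg_left (hle t ⟨ht.1, ht.2.le⟩) hL
      linarith) t ht
  rw [gronwallBound_ε0] at key
  rw [← hvw t ht]
  exact (hle t ht).trans key

section Solutions

variable {Γ E F : Type*} [NormedAddCommGroup E] [NormedSpace ℝ E]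
  {f : ℝ → E → F → Γ → E} {u : ℝ → F} {σ : ℝ → Γ} {D : Set ℝ} {x : ℝ → E}

lemma exists_Icc_mem_nhdsWithin {t : ℝ} (ht : t ∈ D) :
    ∃ a ∈ D, ∃ b ∈ D, t ∈ Icc a b ∧ Icc a b ∈ 𝓝[D] t := by
  have hl : ∃ a ∈ D, a ≤ t ∧ Ici a ∈ 𝓝[D] t := by
    by_cases h : ∃ a ∈ D, a < t
    · obtain ⟨a, ha, hat⟩ := h
      exact ⟨a, ha, hat.le, mem_nhdsWithin_of_mem_nhds (Ici_mem_nhds hat)⟩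
    · push Not at h
      exact ⟨t, ht, le_rfl, mem_of_superset self_mem_nhdsWithin h⟩
  have hr : ∃ b ∈ D, t ≤ b ∧ Iic b ∈ 𝓝[D] t := by
    by_cases h : ∃ b ∈ D, t < b
    · obtain ⟨b, hb, htb⟩ := h
      exact ⟨b, hb, htb.le, mem_nhdsWithin_of_mem_nhds (Iic_mem_nhds htb)⟩
    · push Not at h
      exact ⟨t, ht, le_rfl, mem_of_superset self_mem_nhdsWithin h⟩
  obtain ⟨a, ha, hat, hna⟩ := hl
  obtain ⟨b, hb, htb, hnb⟩ := hr
  exact ⟨a, ha, b, hb, ⟨hat, htb⟩, inter_mem hna hnb⟩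

/-- It suffices to check the integral equation from a single base point; continuity is
automatic. -/
lemma isSolution_of_base (hD : D.OrdConnected) (hD0 : D ⊆ Ici 0) {c : ℝ} (hc : c ∈ D)
    (hint : ∀ t ∈ D, IntervalIntegrable (fun s => f s (x s) (u s) (σ s)) volume c t)
    (heq : ∀ t ∈ D, x t = x c + ∫ s in c..t, f s (x s) (u s) (σ s)) :
    IsSolution f u σ D x := by
  have hint' : ∀ a ∈ D, ∀ b ∈ D,
      IntervalIntegrable (fun s => f s (x s) (u s) (σ s)) volume a b :=
    fun a ha b hb => (hint a ha).symm.trans (hint b hb)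
  have heq' : ∀ a ∈ D, ∀ b ∈ D, x b = x a + ∫ s in a..b, f s (x s) (u s) (σ s) := by
    intro a ha b hb
    rw [heq b hb, heq a ha, add_assoc,
      intervalIntegral.integral_add_adjacent_intervals (hint a ha) (hint' a ha b hb)]
  refine ⟨hD, hD0, ⟨c, hc⟩, fun t ht => ?_, hint', heq'⟩
  obtain ⟨a, ha, b, hb, htab, hn⟩ := exists_Icc_mem_nhdsWithin ht
  have hcont : ContinuousOn x (Icc a b) := by
    have h := intervalIntegral.continuousOn_primitive_interval' (hint' a ha b hb)
      (left_mem_uIcc : a ∈ uIcc a b)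
    rw [uIcc_of_le (htab.1.trans htab.2)] at h
    exact (continuousOn_const.add h).congr fun s hs => heq' a ha s (hD.out ha hb hs)
  exact (hcont t htab).mono_of_mem_nhdsWithin hn

lemma IsSolution.congr (hx : IsSolution f u σ D x) {x' : ℝ → E} (h : EqOn x x' D) :
    IsSolution f u σ D x' := by
  obtain ⟨c, hc⟩ := hx.nonempty
  have hsub {t} (ht : t ∈ D) : uIoc c t ⊆ D :=
    uIoc_subset_uIcc.trans (hx.ordConnected.uIcc_subset hc ht)
  refine isSolution_of_base hx.ordConnected hx.subset_Ici hc (fun t ht => ?_) fun t ht => ?_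
  · refine (hx.intervalIntegrable c hc t ht).congr fun s hs => ?_
    simp only [h (hsub ht hs)]
  · rw [← h hc, ← h ht, hx.integral_eq c hc t ht]
    congr 1
    refine intervalIntegral.integral_congr_ae (ae_of_all _ fun s hs => ?_)
    simp only [h (hsub ht hs)]

lemma IsSolution.mono (hx : IsSolution f u σ D x) {D' : Set ℝ} (hD' : D'.OrdConnected)
    (hne : D'.Nonempty) (h : D' ⊆ D) : IsSolution f u σ D' x :=
  ⟨hD', h.trans hx.subset_Ici, hne, hx.continuousOn.mono h,
    fun a ha b hb => hx.intervalIntegrable a (h ha) b (h hb),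
    fun a ha b hb => hx.integral_eq a (h ha) b (h hb)⟩

/-- Concatenation of a solution whose domain has supremum at most `b` with a solution on
`[b, b + h]`. -/
lemma IsSolution.concat (hx : IsSolution f u σ D x) {a b h : ℝ} (ha : a ∈ D)
    (hDb : ∀ t ∈ D, t ≤ b) (hab : Ico a b ⊆ D) (hh : 0 ≤ h)
    (hint : IntervalIntegrable (fun s => f s (x s) (u s) (σ s)) volume a b)
    {y : ℝ → E} (hy : IsSolution f u σ (Icc b (b + h)) y)
    (hyb : y b = x a + ∫ s in a..b, f s (x s) (u s) (σ s)) :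
    ∃ x', IsSolution f u σ (D ∪ Icc b (b + h)) x' ∧ EqOn x x' D := by
  set x' : ℝ → E := fun t => if t < b then x t else y t with hx'
  have hbb : b ∈ Icc b (b + h) := ⟨le_rfl, by linarith⟩
  have hxx' : EqOn x x' D := by
    intro t ht
    rcases (hDb t ht).lt_or_eq with h | rfl
    · simp [hx', h]
    · simp only [hx', lt_irrefl, if_false]
      rw [hyb, ← hx.integral_eq a ha t ht]
  have hyx' : EqOn y x' (Icc b (b + h)) := fun t ht => by simp [hx', not_lt.2 ht.1]
  refine ⟨x', ?_, hxx'⟩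
  have h1 := hx.congr hxx'
  have h2 := hy.congr hyx'
  have haeq : ∀ᵐ s ∂volume, s ∈ uIoc a b →
      f s (x s) (u s) (σ s) = f s (x' s) (u s) (σ s) := by
    filter_upwards [compl_mem_ae_iff.2 (measure_singleton b)] with s hs hs'
    rw [uIoc_of_le (hDb a ha)] at hs'
    rw [hxx' (hab ⟨hs'.1.le, lt_of_le_of_ne hs'.2 hs⟩)]
  have hint' : IntervalIntegrable (fun s => f s (x' s) (u s) (σ s)) volume a b :=
    hint.congr_ae ((ae_restrict_iff' measurableSet_uIoc).2 haeq)
  refine isSolution_of_base ⟨?_⟩ (union_subset hx.subset_Ici hy.subset_Ici) (Or.inl ha) ?_ ?_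
  · rintro p hp q hq r hr
    rcases lt_or_ge r b with hrb | hrb
    · left
      have hp : p ∈ D := hp.resolve_right fun h => absurd (h.1.trans hr.1) (not_le.2 hrb)
      rcases le_or_gt a r with har | har
      · exact hab ⟨har, hrb⟩
      · exact hx.ordConnected.out hp ha ⟨hr.1, har.le⟩
    · right
      refine ⟨hrb, ?_⟩
      rcases hq with hq | hq
      · linarith [hDb q hq, hr.2]
      · exact hr.2.trans hq.2
  · rintro t (ht | ht)
    · exact h1.intervalIntegrable a ha t ht
    · exact hint'.trans (h2.intervalIntegrable b hbb t ht)
  · rintro t (ht | ht)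
    · exact h1.integral_eq a ha t ht
    · rw [h2.integral_eq b hbb t ht, ← intervalIntegral.integral_add_adjacent_intervals hint'
        (h2.intervalIntegrable b hbb t ht), ← add_assoc, ← hyx' hbb, hyb, ← hxx' ha,
        intervalIntegral.integral_congr_ae haeq]

/-- Every solution extends to a maximal one. -/
lemma IsSolution.exists_maximal (hx : IsSolution f u σ D x) :
    ∃ D' x', IsMaximalSolution f u σ D' x' ∧ D ⊆ D' ∧ EqOn x x' D := by
  let A := {p : Set ℝ × (ℝ → E) // IsSolution f u σ p.1 p.2 ∧ D ⊆ p.1 ∧ EqOn x p.2 D}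
  let ext : A → A → Prop := fun p q => p.1.1 ⊆ q.1.1 ∧ EqOn p.1.2 q.1.2 p.1.1
  have htrans {p q r : A} (h : ext p q) (h' : ext q r) : ext p r :=
    ⟨h.1.trans h'.1, fun t ht => (h.2 ht).trans (h'.2 (h.1 ht))⟩
  have : Nonempty A := ⟨⟨(D, x), hx, Subset.rfl, fun _ _ => rfl⟩⟩
  have hchain : ∀ c, IsChain ext c → c.Nonempty → ∃ ub, ∀ p ∈ c, ext p ub := by
    rintro c hc ⟨p₀, hp₀⟩
    have htot : ∀ p ∈ c, ∀ q ∈ c, ∃ r ∈ c, ext p r ∧ ext q r := by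
      intro p hp q hq
      have hrefl (p : A) : ext p p := ⟨Subset.rfl, fun _ _ => rfl⟩
      by_cases h : p = q
      · exact ⟨p, hp, hrefl p, h ▸ hrefl p⟩
      · rcases hc hp hq h with h | h
        · exact ⟨q, hq, h, hrefl q⟩
        · exact ⟨p, hp, hrefl p, h⟩
    set U : Set ℝ := ⋃ p ∈ c, p.1.1 with hU
    have hmemU {t} : t ∈ U ↔ ∃ p ∈ c, t ∈ p.1.1 := by simp [hU]
    classical
    set X : ℝ → E := fun t => if h : ∃ p ∈ c, t ∈ p.1.1 then h.choose.1.2 t else 0 with hX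
    have hXp : ∀ p ∈ c, EqOn p.1.2 X p.1.1 := by
      intro p hp t ht
      have h : ∃ p ∈ c, t ∈ p.1.1 := ⟨p, hp, ht⟩
      simp only [hX, dif_pos h]
      obtain ⟨r, -, hpr, hqr⟩ := htot p hp _ h.choose_spec.1
      rw [hpr.2 ht, hqr.2 h.choose_spec.2]
    have hsol : ∀ p ∈ c, IsSolution f u σ p.1.1 X := fun p hp => p.2.1.congr (hXp p hp)
    have hpair : ∀ s ∈ U, ∀ t ∈ U, ∃ p ∈ c, s ∈ p.1.1 ∧ t ∈ p.1.1 := by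
      intro s hs t ht
      obtain ⟨p, hp, hsp⟩ := hmemU.1 hs
      obtain ⟨q, hq, htq⟩ := hmemU.1 ht
      obtain ⟨r, hr, hpr, hqr⟩ := htot p hp q hq
      exact ⟨r, hr, hpr.1 hsp, hqr.1 htq⟩
    have hsub : ∀ p ∈ c, p.1.1 ⊆ U := fun p hp t ht => hmemU.2 ⟨p, hp, ht⟩
    obtain ⟨b, hb⟩ := p₀.2.1.nonempty
    have hbU := hsub p₀ hp₀ hb
    have hXsol : IsSolution f u σ U X := by
      refine isSolution_of_base ⟨fun s hs t ht r hr => ?_⟩ (fun t ht => ?_) hbU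
        (fun t ht => ?_) fun t ht => ?_
      · obtain ⟨p, hp, hsp, htp⟩ := hpair s hs t ht
        exact hsub p hp (p.2.1.ordConnected.out hsp htp hr)
      · obtain ⟨p, hp, htp⟩ := hmemU.1 ht
        exact p.2.1.subset_Ici htp
      · obtain ⟨p, hp, hbp, htp⟩ := hpair b hbU t ht
        exact (hsol p hp).intervalIntegrable b hbp t htp
      · obtain ⟨p, hp, hbp, htp⟩ := hpair b hbU t ht
        exact (hsol p hp).integral_eq b hbp t htp
    exact ⟨⟨(U, X), hXsol, p₀.2.2.1.trans (hsub p₀ hp₀),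
      fun t ht => (p₀.2.2.2 ht).trans (hXp p₀ hp₀ (p₀.2.2.1 ht))⟩,
      fun p hp => ⟨hsub p hp, hXp p hp⟩⟩
  obtain ⟨m, hm⟩ := exists_maximal_of_nonempty_chains_bounded (r := ext) hchain htrans
  refine ⟨m.1.1, m.1.2, ⟨m.2.1, fun D' x' hx' hsub heq => ?_⟩, m.2.2⟩
  exact (hm ⟨(D', x'), hx', m.2.2.1.trans hsub,
    fun t ht => (m.2.2.2 ht).trans (heq (m.2.2.1 ht))⟩ ⟨hsub, heq⟩).1

variable [MeasurableSpace E] [BorelSpace E] [FiniteDimensional ℝ E]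
  [NormedAddCommGroup F] [MeasurableSpace F] [BorelSpace F] [SecondCountableTopology F]

lemma IsSwitchingSignal.exists_cover (hσ : IsSwitchingSignal σ) (b : ℝ) :
    ∃ (n : ℕ) (t : ℕ → ℝ), Ico 0 b ⊆ ⋃ i : Fin n, Ico (t i) (t (i + 1)) ∧
      ∀ i : Fin n, ∀ s ∈ Ico (t i) (t (i + 1)), σ s = σ (t i) := by
  obtain ⟨n, t, h0, -, hb, hc⟩ := hσ (max b 1) (by positivity)
  refine ⟨n, t, fun s hs => ?_, fun i => hc i i.2⟩
  have key : ∀ k ≤ n, s < t k → ∃ i : Fin n, s ∈ Ico (t i) (t (i + 1)) := by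
    intro k
    induction k with
    | zero => exact fun _ h => absurd hs.1 (by rw [h0] at h; exact not_le.2 h)
    | succ k ih =>
      intro hk h
      rcases lt_or_ge s (t k) with h' | h'
      · exact ih (by omega) h'
      · exact ⟨⟨k, by omega⟩, h', h⟩
  exact mem_iUnion.2 (key n le_rfl (hs.2.trans_le ((le_max_left _ _).trans hb)))

/-- Composition measurability for the right-hand side along a measurable curve. -/
lemma Regular.aestronglyMeasurable_comp (hreg : Regular f) (hσ : IsSwitchingSignal σ)
    (hu : Measurable u) {s : Set ℝ} {b : ℝ} (hs : s ⊆ Ico 0 b)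
    (hx : AEMeasurable x (volume.restrict s)) :
    AEStronglyMeasurable (fun t => f t (x t) (u t) (σ t)) (volume.restrict s) := by
  obtain ⟨n, t, hcov, hconst⟩ := hσ.exists_cover b
  obtain ⟨x', hx'm, hxx'⟩ := hx
  have hjoint (i : Γ) : Measurable fun τ => f τ (x' τ) (u τ) i := by
    have h : Measurable (Function.uncurry fun (q : E × F) (τ : ℝ) => f τ q.1 q.2 i) :=
      measurable_uncurry_of_continuous_of_measurable (fun τ => hreg.2.2 τ i)
        fun q => hreg.2.1 q.1 q.2 i
    exact h.comp ((hx'm.prodMk hu).prodMk measurable_id)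
  have h : AEStronglyMeasurable (fun τ => f τ (x' τ) (u τ) (σ τ))
      (volume.restrict (⋃ i : Fin n, Ico (t i) (t (i + 1)))) := by
    refine aestronglyMeasurable_iUnion_iff.2 fun i => ?_
    refine (hjoint (σ (t i))).aestronglyMeasurable.congr ?_
    filter_upwards [ae_restrict_mem measurableSet_Ico] with τ hτ
    rw [hconst i τ hτ]
  refine (h.mono_set (hs.trans hcov)).congr ?_
  filter_upwards [hxx'] with τ hτ
  rw [hτ]

/-- Local existence for the switched system. -/
lemma exists_local_solution (hreg : Regular f) {γ : ℝ → ℝ} (hγ : ClassK γ) (hC1 : CondC1 f γ)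
    (hu : IsInput u) (hσ : IsSwitchingSignal σ) {b : ℝ} (hb : 0 ≤ b) (ξ : E) :
    ∃ h > 0, ∃ y, IsSolution f u σ (Icc b (b + h)) y ∧ y b = ξ := by
  obtain ⟨N, hN0, hNmono, hN⟩ := hC1
  obtain ⟨C, hC⟩ := hu.2 (b + 1)
  classical
  set R := ‖ξ‖ + 1 with hR
  have hR0 : 0 ≤ R := by positivity
  set u' : ℝ → F := fun s => if ‖u s‖ ≤ C then u s else 0 with hu'
  have hu'm : Measurable u' :=
    Measurable.ite (measurableSet_le hu.1.norm measurable_const) hu.1 measurable_const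
  have hu'b (s) : ‖u' s‖ ≤ max C 0 := by
    simp only [hu']
    split_ifs with h
    · exact h.trans (le_max_left _ _)
    · simp
  set ψ : E → ℝ := fun w => max 0 (min 1 (R + 1 - ‖w‖)) with hψ
  have hψ0 (w) : 0 ≤ ψ w := le_max_left _ _
  have hψ1 (w) : ψ w ≤ 1 := max_le zero_le_one (min_le_left _ _)
  have hψeq (w) (hw : ‖w‖ ≤ R) : ψ w = 1 := by
    simp only [hψ]
    rw [min_eq_left (by linarith), max_eq_right zero_le_one]
  have hψc : Continuous ψ := by fun_prop
  set g : ℝ → E → E := fun s w =>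
    (Icc b (b + 1)).indicator (fun s => ψ w • f s w (u' s) (σ s)) s with hg
  set M := N (R + 1) * (1 + γ (max C 0)) with hMdef
  have hM0 : 0 ≤ M := mul_nonneg (hN0 _ (by positivity)).le
    (by linarith [hγ.nonneg (le_max_right C 0)])
  have hM (s w) : ‖g s w‖ ≤ M := by
    simp only [hg, indicator]
    split_ifs with hs
    · rw [norm_smul, Real.norm_of_nonneg (hψ0 w)]
      rcases le_or_gt ‖w‖ (R + 1) with hw | hw
      · refine (mul_le_of_le_one_left (norm_nonneg _) (hψ1 w)).trans
          ((hN s (hb.trans hs.1) w _ _).trans ?_)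
        refine mul_le_mul (hNmono (norm_nonneg _) (by simp only [mem_Ici]; positivity) hw)
          (by linarith [hγ.mono (norm_nonneg _) (hu'b s)])
          (by linarith [hγ.nonneg (norm_nonneg (u' s))]) (hN0 _ (by positivity)).le
      · have : ψ w = 0 := by
          simp only [hψ]
          exact max_eq_left ((min_le_right _ _).trans (by linarith))
        simpa [this] using hM0
    · simpa using hM0
  have hgc (s) : Continuous (g s) := by
    simp only [hg, indicator]
    split_ifs with hs
    · exact hψc.smul ((hreg.2.2 s (σ s)).comp (by fun_prop : Continuous fun w => (w, u' s)))
    · exact continuous_const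
  have hgm (y : ℝ → E) (hy : Continuous y) : AEStronglyMeasurable fun s => g s (y s) := by
    have h1 : AEStronglyMeasurable (fun s => f s (y s) (u' s) (σ s))
        (volume.restrict (Icc b (b + 1))) :=
      hreg.aestronglyMeasurable_comp hσ hu'm (b := b + 2)
        (fun s hs => ⟨hb.trans hs.1, by linarith [hs.2]⟩) hy.aemeasurable
    exact (aestronglyMeasurable_indicator_iff measurableSet_Icc).2
      (((hψc.comp hy).aestronglyMeasurable).smul h1)
  obtain ⟨y, hyc, hy⟩ := exists_caratheodory_solution hM hgc hgm b ξ
  have hyb : y b = ξ := by simpa using hy b ⟨le_rfl, by linarith⟩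
  obtain ⟨δ, hδ, hyδ⟩ := Metric.continuousAt_iff.1 (hyc.continuousAt (x := b)) 1 one_pos
  refine ⟨min 1 (δ / 2), by positivity, y, ?_, hyb⟩
  have hae : ∀ᵐ s ∂volume, s ∈ Icc b (b + min 1 (δ / 2)) →
      g s (y s) = f s (y s) (u s) (σ s) := by
    filter_upwards [hC] with s hs hsb
    have hs1 : s ≤ b + 1 := by linarith [hsb.2, min_le_left 1 (δ / 2)]
    have hs2 : s ≤ b + δ / 2 := by linarith [hsb.2, min_le_right 1 (δ / 2)]
    have hyR : ‖y s‖ ≤ R := by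
      have h := hyδ (x := s) (by
        rw [Real.dist_eq, abs_of_nonneg (by linarith [hsb.1])]
        linarith)
      rw [hyb, dist_eq_norm] at h
      linarith [norm_le_norm_add_norm_sub' (y s) ξ]
    have hus : u' s = u s := if_pos (hs ⟨hb.trans hsb.1, hs1⟩)
    simp only [hg, indicator, mem_Icc.2 ⟨hsb.1, hs1⟩, if_true, hψeq _ hyR, one_smul, hus]
  have hsub {t} (ht : t ∈ Icc b (b + min 1 (δ / 2))) :
      uIoc b t ⊆ Icc b (b + min 1 (δ / 2)) := by
    rw [uIoc_of_le ht.1]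
    exact fun s hs => ⟨hs.1.le, hs.2.trans ht.2⟩
  refine isSolution_of_base ordConnected_Icc (fun t ht => hb.trans ht.1)
    (left_mem_Icc.2 (by simp; positivity)) (fun t ht => ?_) fun t ht => ?_
  · refine (intervalIntegrable_comp_of_bound hM hgm hyc b t).congr_ae ?_
    rw [Filter.EventuallyEq, ae_restrict_iff' measurableSet_uIoc]
    filter_upwards [hae] with s hs hst using hs (hsub ht hst)
  · rw [hyb, hy t ⟨ht.1, ht.2.trans (by linarith [min_le_left 1 (δ / 2)])⟩]
    congr 1
    refine intervalIntegral.integral_congr_ae ?_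
    filter_upwards [hae] with s hs hst using hs (hsub ht hst)

/-- A maximal solution that stays bounded on bounded time intervals is forward complete. -/
lemma IsMaximalSolution.Ici_subset_of_bounded (hreg : Regular f) {γ : ℝ → ℝ} (hγ : ClassK γ)
    (hC1 : CondC1 f γ) (hu : IsInput u) (hσ : IsSwitchingSignal σ)
    (hx : IsMaximalSolution f u σ D x) {t₀ : ℝ} (ht₀ : t₀ ∈ D)
    (hbdd : ∀ b, ∃ R, ∀ t ∈ D, t₀ ≤ t → t ≤ b → ‖x t‖ ≤ R) : Ici t₀ ⊆ D := by
  by_contra hnot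
  obtain ⟨T, hT, hTD⟩ := not_subset.1 hnot
  have hord := hx.1.ordConnected
  have hDT : ∀ t ∈ D, t ≤ T := fun t ht => by
    by_contra h
    exact hTD (hord.out ht₀ ht ⟨hT, (not_le.1 h).le⟩)
  set b := sSup D with hb
  have hDb : ∀ t ∈ D, t ≤ b := fun t ht => le_csSup ⟨T, hDT⟩ ht
  have hIco : Ico t₀ b ⊆ D := fun t ht => by
    obtain ⟨s, hs, hts⟩ := exists_lt_of_lt_csSup ⟨t₀, ht₀⟩ ht.2
    exact hord.out ht₀ hs ⟨ht.1, hts.le⟩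
  have ht₀0 : 0 ≤ t₀ := hx.1.subset_Ici ht₀
  have ht₀b : t₀ ≤ b := hDb t₀ ht₀
  obtain ⟨R, hR⟩ := hbdd b
  obtain ⟨N, hN0, hNmono, hN⟩ := id hC1
  obtain ⟨C, hC⟩ := hu.2 b
  have hint : IntervalIntegrable (fun s => f s (x s) (u s) (σ s)) volume t₀ b := by
    rw [intervalIntegrable_iff_integrableOn_Ico_of_le ht₀b]
    refine IntegrableOn.of_bound measure_Ico_lt_top ?_ (N R * (1 + γ C)) ?_
    · exact hreg.aestronglyMeasurable_comp hσ hu.1 (b := b)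
        (fun s hs => ⟨ht₀0.trans hs.1, hs.2⟩)
        ((hx.1.continuousOn.mono hIco).aemeasurable measurableSet_Ico)
    · rw [ae_restrict_iff' measurableSet_Ico]
      filter_upwards [hC] with s hs hst
      have hs0 : 0 ≤ s := ht₀0.trans hst.1
      have h1 := hs ⟨hs0, hst.2.le⟩
      have h2 := hR s (hIco hst) hst.1 hst.2.le
      have hR0 := (norm_nonneg _).trans h2
      exact (hN s hs0 _ _ _).trans (mul_le_mul (hNmono (norm_nonneg _) hR0 h2)
        (by linarith [hγ.mono (norm_nonneg _) h1])
        (by linarith [hγ.nonneg (norm_nonneg (u s))]) (hN0 _ hR0).le)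
  obtain ⟨h, hh, y, hy, hyb⟩ := exists_local_solution hreg hγ hC1 hu hσ (ht₀0.trans ht₀b)
    (x t₀ + ∫ s in t₀..b, f s (x s) (u s) (σ s))
  obtain ⟨x', hx', heq⟩ := hx.1.concat ht₀ hDb hIco hh.le hint hy hyb
  have hmem := hx.2 _ x' hx' subset_union_left heq (Or.inr ⟨by linarith, le_rfl⟩)
  linarith [hDb _ hmem]

end Solutions

section Comparison

lemma exists_input_perturbation_bound {Γ E F : Type*} [NormedAddCommGroup E]
    [NormedAddCommGroup F] {f : ℝ → E → F → Γ → E} {γ : ℝ → ℝ} (hγ : ClassK γ)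
    (hC1 : CondC1 f γ) (hC2 : CondC2 f) {r η : ℝ} (hr : 0 < r) (hη : 0 < η) :
    ∃ κ ≥ 0, ∀ t, 0 ≤ t → ∀ (i : Γ) (ξ : E) (μ : F), ‖ξ‖ ≤ r →
      ‖f t ξ μ i - f t ξ 0 i‖ ≤ η + κ * γ ‖μ‖ := by
  obtain ⟨N, hN0, hNmono, hN⟩ := hC1
  obtain ⟨δ, hδ, h⟩ := hC2 r hr η hη
  have hNr := hN0 r hr.le
  have hγδ := hγ.pos hδ
  refine ⟨N r * (2 / γ δ + 1), by positivity, fun t ht i ξ μ hξ => ?_⟩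
  have hγμ := hγ.nonneg (norm_nonneg μ)
  rcases le_or_gt ‖μ‖ δ with hμ | hμ
  · have : 0 ≤ N r * (2 / γ δ + 1) * γ ‖μ‖ := by positivity
    linarith [h t ht i ξ μ hξ hμ]
  · have hNξ : N ‖ξ‖ ≤ N r := hNmono (norm_nonneg _) hr.le hξ
    have h1 : ‖f t ξ μ i‖ ≤ N r * (1 + γ ‖μ‖) :=
      (hN t ht ξ μ i).trans (mul_le_mul_of_nonneg_right hNξ (by linarith))
    have h2 : ‖f t ξ 0 i‖ ≤ N r := by
      have := hN t ht ξ 0 i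
      rw [norm_zero, hγ.2.2, add_zero, mul_one] at this
      exact this.trans hNξ
    have h3 : 2 ≤ 2 / γ δ * γ ‖μ‖ := by
      rw [div_mul_eq_mul_div, le_div_iff₀ hγδ]
      exact mul_le_mul_of_nonneg_left (hγ.mono hδ.le hμ.le) zero_le_two
    have h4 := norm_sub_le (f t ξ μ i) (f t ξ 0 i)
    nlinarith [mul_le_mul_of_nonneg_left h3 hNr.le]

variable {Γ E F : Type*} [NormedAddCommGroup E] [NormedSpace ℝ E]
  [NormedAddCommGroup F] [MeasurableSpace F]
  {f : ℝ → E → F → Γ → E} {u : ℝ → F} {σ : ℝ → Γ} {S : Set (ℝ → Γ)} {D : Set ℝ} {x : ℝ → E}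

lemma ClassK.measurable_comp_norm [OpensMeasurableSpace F] {χ : ℝ → ℝ} (hχ : ClassK χ)
    (hu : Measurable u) : Measurable fun s => χ ‖u s‖ := by
  have hc : Continuous fun r => χ (max r 0) :=
    hχ.1.comp_continuous (by fun_prop) fun r => mem_Ici.2 (le_max_right _ _)
  simpa [Function.comp_def] using hc.measurable.comp hu.norm

lemma IsInput.intervalIntegrable [OpensMeasurableSpace F] (hu : IsInput u) {χ : ℝ → ℝ}
    (hχ : ClassK χ) {a b : ℝ} (ha : 0 ≤ a) (hab : a ≤ b) :
    IntervalIntegrable (fun s => χ ‖u s‖) volume a b := by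
  obtain ⟨C, hC⟩ := hu.2 b
  rw [intervalIntegrable_iff_integrableOn_Ioc_of_le hab]
  refine IntegrableOn.of_bound measure_Ioc_lt_top
    (hχ.measurable_comp_norm hu.1).aestronglyMeasurable (χ C) ?_
  rw [ae_restrict_iff' measurableSet_Ioc]
  filter_upwards [hC] with s hs hsab
  rw [Real.norm_of_nonneg (hχ.nonneg (norm_nonneg _))]
  exact hχ.mono (norm_nonneg _) (hs ⟨ha.trans hsab.1.le, hsab.2⟩)

lemma isInput_zero : IsInput fun _ : ℝ => (0 : F) :=
  ⟨measurable_const, fun _ => ⟨0, by simp⟩⟩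

lemma norm_sub_le_of_isSolution [OpensMeasurableSpace F] {γ : ℝ → ℝ} (hγ : ClassK γ)
    (hu : IsInput u) {z : ℝ → E} {a b r η κ L : ℝ} (ha : 0 ≤ a) (hab : a ≤ b)
    (hη : 0 ≤ η) (hκ : 0 ≤ κ) (hL : 0 ≤ L)
    (hpert : ∀ t, 0 ≤ t → ∀ (i : Γ) (ξ : E) (μ : F), ‖ξ‖ ≤ r →
      ‖f t ξ μ i - f t ξ 0 i‖ ≤ η + κ * γ ‖μ‖)
    (hlip : ∀ t, 0 ≤ t → ∀ (i : Γ), ∀ ξ ∈ Metric.closedBall (0 : E) r,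
      ∀ ξ' ∈ Metric.closedBall (0 : E) r, ‖f t ξ 0 i - f t ξ' 0 i‖ ≤ L * ‖ξ - ξ'‖)
    (hx : IsSolution f u σ (Icc a b) x) (hz : IsSolution f (fun _ => 0) σ (Icc a b) z)
    (hxz : z a = x a) (hxr : ∀ s ∈ Icc a b, ‖x s‖ ≤ r) (hzr : ∀ s ∈ Icc a b, ‖z s‖ ≤ r) :
    ‖x b - z b‖ ≤ ((b - a) * η + κ * ∫ s in a..b, γ ‖u s‖) * Real.exp (L * (b - a)) := by
  have haa : a ∈ Icc a b := ⟨le_rfl, hab⟩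
  have hw : ContinuousOn (fun t => ‖x t - z t‖) (Icc a b) :=
    (hx.continuousOn.sub hz.continuousOn).norm
  refine le_mul_exp_of_le_integral (w := fun t => ‖x t - z t‖) hw hL (fun t ht => ?_) b
    ⟨hab, le_rfl⟩
  have hxi := hx.intervalIntegrable a haa t ht
  have hzi := hz.intervalIntegrable a haa t ht
  have hγi := hu.intervalIntegrable hγ ha ht.1
  have hwi : IntervalIntegrable (fun t => ‖x t - z t‖) volume a t :=
    (hw.mono (Icc_subset_Icc_right ht.2)).intervalIntegrable_of_Icc ht.1
  have hci : IntervalIntegrable (fun s => η + κ * γ ‖u s‖) volume a t :=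
    intervalIntegrable_const.add (hγi.const_mul κ)
  have heq : x t - z t =
      ∫ s in a..t, (f s (x s) (u s) (σ s) - f s (z s) 0 (σ s)) := by
    rw [hx.integral_eq a haa t ht, hz.integral_eq a haa t ht, hxz,
      intervalIntegral.integral_sub hxi hzi]
    abel
  have hγmono : ∫ s in a..t, γ ‖u s‖ ≤ ∫ s in a..b, γ ‖u s‖ :=
    intervalIntegral.integral_mono_interval le_rfl ht.1 ht.2
      (ae_of_all _ fun _ => hγ.nonneg (norm_nonneg _)) (hu.intervalIntegrable hγ ha hab)
  calc ‖x t - z t‖ ≤ ∫ s in a..t, ‖f s (x s) (u s) (σ s) - f s (z s) 0 (σ s)‖ := by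
        rw [heq]
        exact intervalIntegral.norm_integral_le_integral_norm ht.1
    _ ≤ ∫ s in a..t, ((η + κ * γ ‖u s‖) + L * ‖x s - z s‖) := by
        refine intervalIntegral.integral_mono_on ht.1 (hxi.sub hzi).norm
          (hci.add (hwi.const_mul L)) fun s hs => ?_
        have hs' : s ∈ Icc a b := ⟨hs.1, hs.2.trans ht.2⟩
        have hs0 : 0 ≤ s := ha.trans hs.1
        have h1 := hpert s hs0 (σ s) (x s) (u s) (hxr s hs')
        have h2 := hlip s hs0 (σ s) (x s) (by simpa using hxr s hs') (z s)
          (by simpa using hzr s hs')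
        have h3 := norm_sub_le_norm_sub_add_norm_sub (f s (x s) (u s) (σ s))
          (f s (x s) 0 (σ s)) (f s (z s) 0 (σ s))
        linarith
    _ = (t - a) * η + κ * (∫ s in a..t, γ ‖u s‖) + L * ∫ s in a..t, ‖x s - z s‖ := by
        rw [intervalIntegral.integral_add hci (hwi.const_mul L),
          intervalIntegral.integral_add intervalIntegrable_const (hγi.const_mul κ)]
        simp
    _ ≤ _ := by
        have h1 := mul_le_mul_of_nonneg_left hγmono hκ
        have h2 : (t - a) * η ≤ (b - a) * η :=
          mul_le_mul_of_nonneg_right (by linarith [ht.2]) hη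
        linarith

/-- `x` restricts on `[a, b]` to a maximal solution for the input `u` and a signal in `S`. -/
def IsTrajectory (f : ℝ → E → F → Γ → E) (S : Set (ℝ → Γ)) (u : ℝ → F) (x : ℝ → E)
    (a b : ℝ) : Prop :=
  IsInput u ∧ a ≤ b ∧ ∃ σ ∈ S, ∃ D, IsMaximalSolution f u σ D x ∧ a ∈ D ∧ b ∈ D

namespace IsTrajectory

variable {a b : ℝ}

lemma nonneg (h : IsTrajectory f S u x a b) : 0 ≤ a := by
  obtain ⟨-, -, σ, -, D, hx, ha, -⟩ := h
  exact hx.1.subset_Ici ha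

lemma mono (h : IsTrajectory f S u x a b) {a' b' : ℝ} (ha : a ≤ a') (hab : a' ≤ b')
    (hb : b' ≤ b) : IsTrajectory f S u x a' b' := by
  obtain ⟨hu, -, σ, hσ, D, hx, haD, hbD⟩ := h
  exact ⟨hu, hab, σ, hσ, D, hx, hx.1.ordConnected.out haD hbD ⟨ha, hab.trans hb⟩,
    hx.1.ordConnected.out haD hbD ⟨ha.trans hab, hb⟩⟩

lemma integral_nonneg {χ : ℝ → ℝ} (hχ : ClassK χ) (h : IsTrajectory f S u x a b) :
    0 ≤ ∫ s in a..b, χ ‖u s‖ :=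
  intervalIntegral.integral_nonneg h.2.1 fun _ _ => hχ.nonneg (norm_nonneg _)

lemma integral_mono [OpensMeasurableSpace F] {χ : ℝ → ℝ} (hχ : ClassK χ)
    (h : IsTrajectory f S u x a b) {a' b' : ℝ} (ha : a ≤ a') (hab : a' ≤ b') (hb : b' ≤ b) :
    ∫ s in a'..b', χ ‖u s‖ ≤ ∫ s in a..b, χ ‖u s‖ :=
  intervalIntegral.integral_mono_interval ha hab hb
    (ae_of_all _ fun _ => hχ.nonneg (norm_nonneg _)) (h.1.intervalIntegrable hχ h.nonneg h.2.1)

end IsTrajectory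

/-- Over a bounded time horizon and for bounded states, an input of small energy perturbs the
zero-input decay estimate only slightly. -/
lemma exists_energy_close [MeasurableSpace E] [BorelSpace E] [FiniteDimensional ℝ E]
    [BorelSpace F] [SecondCountableTopology F] (hreg : Regular f)
    (hS : ∀ σ ∈ S, IsSwitchingSignal σ) {γ : ℝ → ℝ} (hA : AssumptionA f γ)
    (hFC : ForwardComplete f S) {β : ℝ → ℝ → ℝ} (hβ : ClassKL β)
    (hguas : ∀ t₀, 0 ≤ t₀ → ∀ σ ∈ S, ∀ D x,
      IsMaximalSolution f (fun _ => (0 : F)) σ D x → t₀ ∈ D → ∀ t ∈ D, t₀ ≤ t →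
        ‖x t‖ ≤ β ‖x t₀‖ (t - t₀))
    {r T ε : ℝ} (hr : 0 < r) (hT : 0 ≤ T) (hε : 0 < ε) :
    ∃ δ > 0, ∀ u x a b, IsTrajectory f S u x a b → b - a ≤ T → (∀ s ∈ Icc a b, ‖x s‖ ≤ r) →
      ∫ s in a..b, γ ‖u s‖ ≤ δ → ‖x b‖ ≤ β ‖x a‖ (b - a) + ε := by
  obtain ⟨hγ, hC1, hC2, hC3⟩ := hA
  set r' := max r (β r 0) with hr'
  have hr'0 : 0 < r' := hr.trans_le (le_max_left _ _)
  obtain ⟨L, hL, hlip⟩ := hC3 (Metric.closedBall 0 r') (isCompact_closedBall 0 r')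
  set e := Real.exp (L * T) with he
  have he0 : 0 < e := Real.exp_pos _
  set η := ε / (2 * (T + 1) * e) with hη
  have hη0 : 0 < η := by positivity
  obtain ⟨κ, hκ, hpert⟩ := exists_input_perturbation_bound hγ hC1 hC2 hr'0 hη0
  refine ⟨ε / (2 * (κ + 1) * e), by positivity, fun u x a b htr hbT hxr hen => ?_⟩
  have ha0 := htr.nonneg
  have hint0 := htr.integral_nonneg hγ
  obtain ⟨hu, hab, σ, hσ, D, hx, ha, hb⟩ := htr
  obtain ⟨h, hh, z₀, hz₀, hz₀a⟩ :=
    exists_local_solution hreg hγ hC1 (isInput_zero (F := F)) (hS σ hσ) ha0 (x a)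
  obtain ⟨Dz, z, hz, hsub, hzz⟩ := hz₀.exists_maximal
  have haI : a ∈ Icc a (a + h) := ⟨le_rfl, by linarith⟩
  have hza : z a = x a := (hzz haI).symm.trans hz₀a
  have haz : a ∈ Dz := hsub haI
  have hDz : Ici a ⊆ Dz := hFC a ha0 _ isInput_zero σ hσ Dz z hz haz
  have hzdec : ∀ s, a ≤ s → ‖z s‖ ≤ β ‖x a‖ (s - a) := fun s hs => by
    have := hguas a ha0 σ hσ Dz z hz haz s (hDz hs) hs
    rwa [hza] at this
  have hzr : ∀ s ∈ Icc a b, ‖z s‖ ≤ r' := fun s hs => by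
    have h1 : β ‖x a‖ (s - a) ≤ β ‖x a‖ 0 :=
      (hβ.2 _ (norm_nonneg _)).1 (mem_Ici.2 le_rfl) (mem_Ici.2 (by linarith [hs.1]))
        (by linarith [hs.1])
    have h2 : β ‖x a‖ 0 ≤ β r 0 :=
      (hβ.1 0 le_rfl).1.mono (norm_nonneg _) (hxr a ⟨le_rfl, hab⟩)
    exact ((hzdec s hs.1).trans (h1.trans h2)).trans (le_max_right _ _)
  have hne : (Icc a b).Nonempty := nonempty_Icc.2 hab
  have hcmp := norm_sub_le_of_isSolution hγ hu ha0 hab hη0.le hκ hL hpert hlip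
    (hx.1.mono ordConnected_Icc hne (hx.1.ordConnected.out ha hb))
    (hz.1.mono ordConnected_Icc hne (Icc_subset_Ici_self.trans hDz)) hza
    (fun s hs => (hxr s hs).trans (le_max_left _ _)) hzr
  have hsmall : ((b - a) * η + κ * ∫ s in a..b, γ ‖u s‖) * Real.exp (L * (b - a)) ≤ ε := by
    have h1 : Real.exp (L * (b - a)) ≤ e :=
      Real.exp_le_exp.2 (mul_le_mul_of_nonneg_left hbT hL)
    have h2 : (b - a) * η ≤ (T + 1) * η := mul_le_mul_of_nonneg_right (by linarith) hη0.le
    have h3 : κ * ∫ s in a..b, γ ‖u s‖ ≤ (κ + 1) * (ε / (2 * (κ + 1) * e)) :=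
      mul_le_mul (by linarith) hen hint0 (by linarith)
    have h4 : (T + 1) * η = ε / (2 * e) := by
      rw [hη]
      field_simp
    have h5 : (κ + 1) * (ε / (2 * (κ + 1) * e)) = ε / (2 * e) := by
      field_simp
    have h6 : ε / (2 * e) + ε / (2 * e) = ε / e := by
      field_simp
      ring
    calc _ ≤ ε / e * e := mul_le_mul (by linarith) h1 (Real.exp_pos _).le (by positivity)
      _ = ε := div_mul_cancel₀ _ he0.ne'
  have h1 := norm_le_norm_add_norm_sub' (x b) (z b)
  linarith [hzdec b hab]

end Comparison

section Stability

lemma ClassKL.mono {β : ℝ → ℝ → ℝ} (hβ : ClassKL β) {r r' t t' : ℝ} (hr : 0 ≤ r)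
    (hrr : r ≤ r') (ht : 0 ≤ t) (htt : t ≤ t') : β r t' ≤ β r' t :=
  ((hβ.2 r hr).1 (mem_Ici.2 ht) (mem_Ici.2 (ht.trans htt)) htt).trans
    ((hβ.1 t ht).1.mono hr hrr)

lemma ClassKL.exists_le {β : ℝ → ℝ → ℝ} (hβ : ClassKL β) {r ε : ℝ} (hr : 0 ≤ r) (hε : 0 < ε) :
    ∃ T ≥ 1, β r T ≤ ε :=
  (((eventually_ge_atTop (1 : ℝ)).and
    ((hβ.2 r hr).2.eventually (eventually_le_nhds hε))).exists)

variable {Γ E F : Type*} [NormedAddCommGroup E] [NormedSpace ℝ E]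
  [NormedAddCommGroup F] [MeasurableSpace F]
  {f : ℝ → E → F → Γ → E} {S : Set (ℝ → Γ)} {χ : ℝ → ℝ} {β : ℝ → ℝ → ℝ}

lemma UBEBS.forwardComplete [MeasurableSpace E] [BorelSpace E] [FiniteDimensional ℝ E]
    [BorelSpace F] [SecondCountableTopology F] (hreg : Regular f)
    (hS : ∀ σ ∈ S, IsSwitchingSignal σ) {γ α : ℝ → ℝ} (hA : AssumptionA f γ) (hα : ClassK α)
    (h : UBEBS f S α) : ForwardComplete f S := by
  obtain ⟨α₁, α₂, c, -, hα₂, -, h⟩ := h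
  intro t₀ ht₀ u hu σ hσ D x hx ht₀D
  refine hx.Ici_subset_of_bounded hreg hA.1 hA.2.1 hu (hS σ hσ) ht₀D fun b =>
    ⟨α₁ ‖x t₀‖ + α₂ (∫ s in t₀..b, α ‖u s‖) + c, fun t htD ht htb => ?_⟩
  have h1 : ∫ s in t₀..t, α ‖u s‖ ≤ ∫ s in t₀..b, α ‖u s‖ :=
    intervalIntegral.integral_mono_interval le_rfl ht htb
      (ae_of_all _ fun _ => hα.nonneg (norm_nonneg _))
      (hu.intervalIntegrable hα ht₀ (ht.trans htb))
  have h2 : 0 ≤ ∫ s in t₀..t, α ‖u s‖ :=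
    intervalIntegral.integral_nonneg ht fun _ _ => hα.nonneg (norm_nonneg _)
  linarith [h t₀ ht₀ u hu σ hσ D x hx ht₀D t htD ht, hα₂.mono h2 h1]

/-- The zero-input decay estimate `β` survives, up to any prescribed error, over bounded horizons
for bounded trajectories whose input has small `χ`-energy. -/
def ClosesToDecay (f : ℝ → E → F → Γ → E) (S : Set (ℝ → Γ)) (χ : ℝ → ℝ)
    (β : ℝ → ℝ → ℝ) : Prop :=
  ∀ r T ε : ℝ, 0 < r → 0 ≤ T → 0 < ε → ∃ δ > 0, ∀ u x a b, IsTrajectory f S u x a b →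
    b - a ≤ T → (∀ s ∈ Icc a b, ‖x s‖ ≤ r) → ∫ s in a..b, χ ‖u s‖ ≤ δ →
      ‖x b‖ ≤ β ‖x a‖ (b - a) + ε

lemma ClosesToDecay.exists_small [OpensMeasurableSpace F] (hclose : ClosesToDecay f S χ β)
    (hχ : ClassK χ) (hβ : ClassKL β) {α₁ α₂ : ℝ → ℝ} {c : ℝ} (hα₁ : ClassK α₁)
    (hα₂ : ClassK α₂) (hc : 0 ≤ c)
    (hB : ∀ u x a b, IsTrajectory f S u x a b →
      ‖x b‖ ≤ α₁ ‖x a‖ + α₂ (∫ s in a..b, χ ‖u s‖) + c) {ε : ℝ} (hε : 0 < ε) :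
    ∃ δ > 0, ∀ u x a b, IsTrajectory f S u x a b → ‖x a‖ ≤ δ →
      ∫ s in a..b, χ ‖u s‖ ≤ δ → ‖x b‖ ≤ ε := by
  obtain ⟨δ₀, hδ₀, hβδ₀⟩ := (hβ.1 0 le_rfl).1.exists_le (half_pos hε)
  set δ₁ := min δ₀ ε with hδ₁
  have hδ₁0 : 0 < δ₁ := lt_min hδ₀ hε
  have hβδ₁ : β δ₁ 0 ≤ ε / 2 := (hβ.mono hδ₁0.le (min_le_left _ _) le_rfl le_rfl).trans hβδ₀
  obtain ⟨T, hT1, hT⟩ := hβ.exists_le hδ₁0.le (half_pos hδ₁0)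
  have hT0 : 0 < T := by linarith
  have hr : 0 < α₁ δ₁ + α₂ 1 + c + 1 := by
    linarith [hα₁.nonneg hδ₁0.le, hα₂.nonneg zero_le_one]
  obtain ⟨δ₂, hδ₂, hδ₂'⟩ := hclose _ T (δ₁ / 2) hr hT0.le (half_pos hδ₁0)
  refine ⟨min δ₁ (min δ₂ 1), by positivity, fun u x a b htr hxa hE => ?_⟩
  obtain ⟨hxa, -⟩ := le_min_iff.1 hxa
  obtain ⟨-, hE⟩ := le_min_iff.1 hE
  obtain ⟨hE₂, hE₁⟩ := le_min_iff.1 hE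
  have hxr : ∀ s ∈ Icc a b, ‖x s‖ ≤ α₁ δ₁ + α₂ 1 + c + 1 := fun s hs => by
    have hs' := htr.mono le_rfl hs.1 hs.2
    have h1 := hα₁.mono (norm_nonneg _) hxa
    have h2 := hα₂.mono (hs'.integral_nonneg hχ)
      ((htr.integral_mono hχ le_rfl hs.1 hs.2).trans hE₁)
    linarith [hB u x a s hs']
  have hleg : ∀ a' b', a ≤ a' → a' ≤ b' → b' ≤ b → b' - a' ≤ T → ‖x a'‖ ≤ δ₁ →
      ‖x b'‖ ≤ β δ₁ (b' - a') + δ₁ / 2 := fun a' b' ha hab hb hbT hxa' => by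
    have h1 := hδ₂' u x a' b' (htr.mono ha hab hb) hbT
      (fun s hs => hxr s ⟨ha.trans hs.1, hs.2.trans hb⟩)
      ((htr.integral_mono hχ ha hab hb).trans hE₂)
    have h2 := hβ.mono (norm_nonneg _) hxa' (sub_nonneg.2 hab) le_rfl
    linarith
  have hgrid : ∀ k : ℕ, a + k * T ≤ b → ‖x (a + k * T)‖ ≤ δ₁ := by
    intro k
    induction k with
    | zero => intro _; simpa using hxa
    | succ k ih =>
      intro hk
      push_cast at hk ⊢
      have hkT : a + k * T ≤ a + (k + 1) * T := by linarith
      have hka : 0 ≤ k * T := by positivity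
      have h1 := hleg (a + k * T) (a + (k + 1) * T) (by linarith) hkT hk (by linarith)
        (ih (hkT.trans hk))
      rw [show a + (k + 1) * T - (a + k * T) = T by ring] at h1
      linarith
  have hab : 0 ≤ (b - a) / T := div_nonneg (sub_nonneg.2 htr.2.1) hT0.le
  have h1 := (le_div_iff₀ hT0).1 (Nat.floor_le hab)
  have h2 := (div_lt_iff₀ hT0).1 (Nat.lt_floor_add_one ((b - a) / T))
  set k := ⌊(b - a) / T⌋₊
  have hka : 0 ≤ k * T := by positivity
  have hkb : a + k * T ≤ b := by linarith
  have h3 := hleg (a + k * T) b (by linarith) hkb le_rfl (by linarith) (hgrid k hkb)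
  have h4 := hβ.mono hδ₁0.le le_rfl le_rfl (sub_nonneg.2 hkb)
  have h5 : δ₁ ≤ ε := min_le_right _ _
  linarith

lemma IsTrajectory.exists_window_le [OpensMeasurableSpace F] (hχ : ClassK χ) {u : ℝ → F}
    {x : ℝ → E} {a b T δ R : ℝ} (h : IsTrajectory f S u x a b) (hT : 0 ≤ T) {n : ℕ}
    (hn : R < n * δ) (hb : a + n * T ≤ b) (hE : ∫ s in a..b, χ ‖u s‖ ≤ R) :
    ∃ k < n, ∫ s in (a + k * T)..(a + (k + 1) * T), χ ‖u s‖ ≤ δ := by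
  by_contra! hcon
  have hkT : ∀ k : ℕ, 0 ≤ k * T := fun k => by positivity
  have hsum : ∀ k ≤ n, k * δ ≤ ∫ s in a..(a + k * T), χ ‖u s‖ := by
    intro k
    induction k with
    | zero => simp
    | succ k ih =>
      intro hk
      have h1 := ih (by omega)
      have h2 := hcon k (by omega)
      push_cast
      rw [← intervalIntegral.integral_add_adjacent_intervals (b := a + k * T)
        (h.1.intervalIntegrable hχ h.nonneg (by linarith [hkT k]))
        (h.1.intervalIntegrable hχ (by linarith [hkT k, h.nonneg]) (by linarith))]
      linarith
  linarith [hsum n le_rfl, h.integral_mono hχ le_rfl (by linarith [hkT n]) hb]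

lemma ClosesToDecay.exists_attraction_time [OpensMeasurableSpace F]
    (hclose : ClosesToDecay f S χ β) (hχ : ClassK χ) (hβ : ClassKL β) {a : ℝ → ℝ}
    (ha : ClassKInf a)
    (hB : ∀ u x t₀ t, IsTrajectory f S u x t₀ t →
      ‖x t‖ ≤ a ‖x t₀‖ + a (∫ s in t₀..t, χ ‖u s‖)) {R ε : ℝ} (hR : 0 ≤ R) (hε : 0 < ε) :
    ∃ T, ∀ u x t₀ t, IsTrajectory f S u x t₀ t → ‖x t₀‖ ≤ R →
      ∫ s in t₀..t, χ ‖u s‖ ≤ R → T ≤ t - t₀ →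
        ‖x t‖ ≤ ε + a (∫ s in t₀..t, χ ‖u s‖) := by
  obtain ⟨δ, hδ, haδ⟩ := ha.1.exists_le hε
  have hr : 0 < a R + a R + 1 := by linarith [ha.1.nonneg hR]
  obtain ⟨T₁, hT₁, hβT₁⟩ := hβ.exists_le hr.le (half_pos hδ)
  have hT₁0 : 0 ≤ T₁ := by linarith
  obtain ⟨δ₂, hδ₂, hδ₂'⟩ := hclose _ T₁ (δ / 2) hr hT₁0 (half_pos hδ)
  obtain ⟨n, hn⟩ := exists_nat_gt (R / δ₂)
  rw [div_lt_iff₀ hδ₂] at hn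
  refine ⟨n * T₁, fun u x t₀ t htr hx hE hT => ?_⟩
  obtain ⟨k, hkn, hk⟩ := htr.exists_window_le hχ hT₁0 hn (by linarith) hE
  have hkn' : ((k : ℝ) + 1) * T₁ ≤ n * T₁ :=
    mul_le_mul_of_nonneg_right (by exact_mod_cast hkn) hT₁0
  have hk0 : 0 ≤ k * T₁ := by positivity
  have ha₁ : t₀ ≤ t₀ + k * T₁ := by linarith
  have hab₁ : t₀ + k * T₁ ≤ t₀ + (k + 1) * T₁ := by linarith
  have hb₁ : t₀ + (k + 1) * T₁ ≤ t := by linarith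
  have hxr : ∀ s ∈ Icc t₀ t, ‖x s‖ ≤ a R + a R + 1 := fun s hs => by
    have hs' := htr.mono le_rfl hs.1 hs.2
    have h1 := ha.1.mono (norm_nonneg _) hx
    have h2 := ha.1.mono (hs'.integral_nonneg hχ)
      ((htr.integral_mono hχ le_rfl hs.1 hs.2).trans hE)
    linarith [hB u x t₀ s hs']
  have h1 := hδ₂' u x _ _ (htr.mono ha₁ hab₁ hb₁) (by linarith)
    (fun s hs => hxr s ⟨ha₁.trans hs.1, hs.2.trans hb₁⟩) hk
  rw [show t₀ + (k + 1) * T₁ - (t₀ + k * T₁) = T₁ by ring] at h1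
  have h2 := hβ.mono (norm_nonneg _) (hxr _ ⟨ha₁, hab₁.trans hb₁⟩) hT₁0 le_rfl
  have htr' := htr.mono (ha₁.trans hab₁) hb₁ le_rfl
  have h3 := ha.1.mono (norm_nonneg _) (show ‖x (t₀ + (k + 1) * T₁)‖ ≤ δ by linarith)
  have h4 := ha.1.mono (htr'.integral_nonneg hχ)
    (htr.integral_mono hχ (ha₁.trans hab₁) hb₁ le_rfl)
  linarith [hB u x _ t htr']

lemma ClosesToDecay.exists_estimate [OpensMeasurableSpace F] (hclose : ClosesToDecay f S χ β)
    (hχ : ClassK χ) (hβ : ClassKL β) {α₁ α₂ : ℝ → ℝ} {c : ℝ} (hα₁ : ClassK α₁)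
    (hα₂ : ClassK α₂) (hc : 0 ≤ c)
    (hB : ∀ u x a b, IsTrajectory f S u x a b →
      ‖x b‖ ≤ α₁ ‖x a‖ + α₂ (∫ s in a..b, χ ‖u s‖) + c) :
    ∃ β' ρ, ClassKL β' ∧ ClassK ρ ∧ ∀ u x a b, IsTrajectory f S u x a b →
      ‖x b‖ ≤ β' ‖x a‖ (b - a) + ρ (∫ s in a..b, χ ‖u s‖) := by
  obtain ⟨a, ha, hbound⟩ := exists_classKInf_bound
    (P := fun r e v => ∃ (u : ℝ → F) (x : ℝ → E) (t₀ t : ℝ), IsTrajectory f S u x t₀ t ∧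
      r = ‖x t₀‖ ∧ e = ∫ s in t₀..t, χ ‖u s‖ ∧ v = ‖x t‖)
    (by
      rintro _ _ _ ⟨u, x, t₀, t, htr, rfl, rfl, rfl⟩
      exact ⟨norm_nonneg _, htr.integral_nonneg hχ⟩)
    (fun ε hε => by
      obtain ⟨δ, hδ, h⟩ := hclose.exists_small hχ hβ hα₁ hα₂ hc hB hε
      refine ⟨δ, hδ, ?_⟩
      rintro _ _ _ ⟨u, x, t₀, t, htr, rfl, rfl, rfl⟩
      exact h u x t₀ t htr)
    (fun R => by
      refine ⟨α₁ R + α₂ R + c, ?_⟩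
      rintro _ _ _ ⟨u, x, t₀, t, htr, rfl, rfl, rfl⟩ hr he
      linarith [hB u x t₀ t htr, hα₁.mono (norm_nonneg _) hr,
        hα₂.mono (htr.integral_nonneg hχ) he])
  have hbound' : ∀ u x t₀ t, IsTrajectory f S u x t₀ t →
      ‖x t‖ ≤ a ‖x t₀‖ + a (∫ s in t₀..t, χ ‖u s‖) := fun u x t₀ t htr =>
    hbound _ _ _ ⟨u, x, t₀, t, htr, rfl, rfl, rfl⟩
  obtain ⟨β', ρ, hβ', hρ, h⟩ := exists_classKL_bound
    (P := fun r e s v => ∃ (u : ℝ → F) (x : ℝ → E) (t₀ t : ℝ), IsTrajectory f S u x t₀ t ∧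
      r = ‖x t₀‖ ∧ e = ∫ s in t₀..t, χ ‖u s‖ ∧ s = t - t₀ ∧ v = ‖x t‖) ha
    (by
      rintro _ _ _ _ ⟨u, x, t₀, t, htr, rfl, rfl, rfl, rfl⟩
      exact ⟨norm_nonneg _, htr.integral_nonneg hχ, sub_nonneg.2 htr.2.1⟩)
    (by
      rintro _ _ _ _ ⟨u, x, t₀, t, htr, rfl, rfl, rfl, rfl⟩
      exact hbound' u x t₀ t htr)
    (fun R hR ε hε => by
      obtain ⟨T, h⟩ := hclose.exists_attraction_time hχ hβ ha hbound' hR hε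
      refine ⟨T, ?_⟩
      rintro _ _ _ _ ⟨u, x, t₀, t, htr, rfl, rfl, rfl, rfl⟩
      exact h u x t₀ t htr)
  exact ⟨β', ρ, hβ', hρ, fun u x t₀ t htr =>
    h _ _ _ _ ⟨u, x, t₀, t, htr, rfl, rfl, rfl, rfl⟩⟩

lemma IsInput.exists_tail_le [OpensMeasurableSpace F] {u : ℝ → F} (hu : IsInput u)
    (hχ : ClassK χ) (hE : Energy χ u ≠ ⊤) {δ : ℝ} (hδ : 0 < δ) {t₀ : ℝ} (ht₀ : 0 ≤ t₀) :
    ∃ t₁ ≥ t₀, ∀ t ≥ t₁, ∫ s in t₁..t, χ ‖u s‖ ≤ δ := by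
  have hnn : ∀ s, 0 ≤ χ ‖u s‖ := fun s => hχ.nonneg (norm_nonneg _)
  have hint : IntegrableOn (fun s => χ ‖u s‖) (Ioi 0) :=
    ⟨(hχ.measurable_comp_norm hu.1).aestronglyMeasurable, by
      rw [hasFiniteIntegral_iff_ofReal (ae_of_all _ hnn)]
      exact lt_top_iff_ne_top.2 hE⟩
  have hlim := intervalIntegral_tendsto_integral_Ioi 0 hint tendsto_id
  obtain ⟨t₁, ht₁, h⟩ := ((eventually_ge_atTop t₀).and
    (hlim.eventually (eventually_gt_nhds (sub_lt_self _ hδ)))).exists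
  refine ⟨t₁, ht₁, fun t ht => ?_⟩
  have h1 : ∫ s in (0 : ℝ)..t, χ ‖u s‖ ≤ ∫ s in Ioi (0 : ℝ), χ ‖u s‖ := by
    rw [intervalIntegral.integral_of_le (ht₀.trans (ht₁.trans ht))]
    exact setIntegral_mono_set hint (ae_of_all _ hnn) Ioc_subset_Ioi_self.eventuallyLE
  have h2 := intervalIntegral.integral_add_adjacent_intervals
    (hu.intervalIntegrable hχ le_rfl (ht₀.trans ht₁))
    (hu.intervalIntegrable hχ (ht₀.trans ht₁) ht)
  simp only [id] at h
  linarith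

lemma IISS.beics [OpensMeasurableSpace F] (hχ : ClassK χ) (h : IISS f S χ) : BEICS f S χ := by
  obtain ⟨hFC, β, ρ, hβ, hρ, h⟩ := h
  intro t₀ ht₀ u hu σ hσ D x hx ht₀D hE
  have hD := hFC t₀ ht₀ u hu σ hσ D x hx ht₀D
  refine ⟨hD, Metric.tendsto_atTop.2 fun ε hε => ?_⟩
  obtain ⟨δ, hδ, hρδ⟩ := hρ.exists_le (half_pos hε)
  obtain ⟨t₁, ht₁, htail⟩ := hu.exists_tail_le hχ hE hδ ht₀
  obtain ⟨T, hT1, hT⟩ := hβ.exists_le (norm_nonneg (x t₁)) (show 0 < ε / 4 by linarith)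
  refine ⟨t₁ + T, fun t ht => ?_⟩
  have htt : t₁ ≤ t := by linarith
  have h1 := h t₁ (ht₀.trans ht₁) u hu σ hσ D x hx (hD ht₁) t (hD (ht₁.trans htt)) htt
  have h2 := hβ.mono (norm_nonneg (x t₁)) le_rfl (show 0 ≤ T by linarith)
    (show T ≤ t - t₁ by linarith)
  have h3 := hρ.mono (intervalIntegral.integral_nonneg htt
    fun s _ => hχ.nonneg (norm_nonneg (u s))) (htail t htt)
  rw [dist_zero_right]
  linarith

theorem UBEBS.iiss [MeasurableSpace E] [BorelSpace E] [FiniteDimensional ℝ E]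
    [BorelSpace F] [SecondCountableTopology F] (hreg : Regular f)
    (hS : ∀ σ ∈ S, IsSwitchingSignal σ) {γ α : ℝ → ℝ} (hA : AssumptionA f γ) (hα : ClassK α)
    (hGUAS : ZeroGUAS f S) (hUBEBS : UBEBS f S α) :
    IISS f S fun s => max (α s) (γ s) := by
  have hFC := hUBEBS.forwardComplete hreg hS hA hα
  have hχ := classK_max hα hA.1
  obtain ⟨β, hβ, hguas⟩ := hGUAS
  obtain ⟨α₁, α₂, c, hα₁, hα₂, hc, hB⟩ := hUBEBS
  have hclose : ClosesToDecay f S (fun s => max (α s) (γ s)) β := fun r T ε hr hT hε => by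
    obtain ⟨δ, hδ, h⟩ := exists_energy_close hreg hS hA hFC hβ hguas hr hT hε
    refine ⟨δ, hδ, fun u x a b htr hbT hxr hE => h u x a b htr hbT hxr (le_trans ?_ hE)⟩
    exact intervalIntegral.integral_mono htr.2.1
      (htr.1.intervalIntegrable hA.1 htr.nonneg htr.2.1)
      (htr.1.intervalIntegrable hχ htr.nonneg htr.2.1) fun s => le_max_right _ _
  have hB' : ∀ u x a b, IsTrajectory f S u x a b →
      ‖x b‖ ≤ α₁ ‖x a‖ + α₂ (∫ s in a..b, max (α ‖u s‖) (γ ‖u s‖)) + c :=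
    fun u x a b htr => by
    have h1 := hα₂.mono (htr.integral_nonneg hα) (intervalIntegral.integral_mono htr.2.1
      (htr.1.intervalIntegrable hα htr.nonneg htr.2.1)
      (htr.1.intervalIntegrable hχ htr.nonneg htr.2.1) fun s => le_max_left _ _)
    have ha := htr.nonneg
    obtain ⟨hu, hab, σ, hσ, D, hx, haD, hbD⟩ := htr
    linarith [hB a ha u hu σ hσ D x hx haD b hbD hab]
  obtain ⟨β', ρ, hβ', hρ, h⟩ := hclose.exists_estimate hχ hβ hα₁ hα₂ hc hB'
  exact ⟨hFC, β', ρ, hβ', hρ, fun t₀ _ u hu σ hσ D x hx ht₀ t ht htt =>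
    h u x t₀ t ⟨hu, htt, σ, hσ, D, hx, ht₀, ht⟩⟩

end Stability

/-- Theorem 1, part (b): under Assumption A with `γ` as in (C1), if the
system is 0-GUAS w.r.t. `S` and UBEBS w.r.t. `S` with UBEBS gain `α`, then it is iISS w.r.t.
`S` with iISS gain `χ = max {α, γ}` and has the `χ`-BEICS property w.r.t. `S`. -/
theorem stmt6 {n m : ℕ} {Γ : Type*} [Nonempty Γ]
    (f : ℝ → EuclideanSpace ℝ (Fin n) → EuclideanSpace ℝ (Fin m) → Γ → EuclideanSpace ℝ (Fin n))
    (hreg : Regular f)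
    (S : Set (ℝ → Γ)) (hS : ∀ σ ∈ S, IsSwitchingSignal σ)
    (γ : ℝ → ℝ) (hA : AssumptionA f γ)
    (α : ℝ → ℝ) (hα : ClassK α)
    (hGUAS : ZeroGUAS f S) (hUBEBS : UBEBS f S α) :
    IISS f S (fun s => max (α s) (γ s)) ∧ BEICS f S (fun s => max (α s) (γ s)) := by
  have h := hUBEBS.iiss hreg hS hA hα hGUAS
  exact ⟨h, h.beics (classK_max hα hA.1)⟩
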